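/- For every N ≥ 2, θ ∈ (0, π/2], ã > 0, d > 0 and m > 0 there exists a constant C > 0, depending only on N, θ, ã, d and m, such that the following holds: for every bounded domain Ω ⊂ ℝ^N with diameter at most d satisfying the (θ,ã)-uniform interior cone condition and every torsion function u on Ω which is C¹ up to the boundary with |∇u(x)| ≥ m for all x ∈ ∂Ω and ∫_Ω |∇²u|² dx < ∞, the function h(x) := |x−z|²/2 − u(x), with z the barycenter of Ω, satisfies ∫_{∂Ω} |∇h|² dH^{N−1} ≤ C ∫_Ω (−u) |∇²h|² dx. -/

import Mathlib

open MeasureTheory Metric Set Real RealInnerProductSpace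

noncomputable section

/-- Euclidean space `ℝ^N`. -/
abbrev Euc (N : ℕ) : Type := EuclideanSpace ℝ (Fin N)

/-- The `(i,j)` entry of the Hessian matrix of `u` at `x`. -/
def hessEntry {N : ℕ} (u : Euc N → ℝ) (x : Euc N) (i j : Fin N) : ℝ :=
  fderiv ℝ (fun y => fderiv ℝ u y (EuclideanSpace.single j (1 : ℝ))) x
    (EuclideanSpace.single i (1 : ℝ))

/-- Squared Frobenius norm of the Hessian of `u` at `x`. -/
def hessNormSq {N : ℕ} (u : Euc N → ℝ) (x : Euc N) : ℝ :=
  ∑ i, ∑ j, (hessEntry u x i j) ^ 2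

/-- The Laplacian of `u` at `x` (trace of the Hessian). -/
def lap {N : ℕ} (u : Euc N → ℝ) (x : Euc N) : ℝ := ∑ i, hessEntry u x i i

/-- `u` is a torsion function on `Ω`: continuous on the closure, `C²` inside,
`Δu = N` in `Ω` and `u = 0` on `∂Ω`. -/
def IsTorsion {N : ℕ} (Ω : Set (Euc N)) (u : Euc N → ℝ) : Prop :=
  ContinuousOn u (closure Ω) ∧ ContDiffOn ℝ 2 u Ω ∧
    (∀ x ∈ Ω, lap u x = N) ∧ ∀ x ∈ frontier Ω, u x = 0

/-- `G` is a `b₀`-John domain. -/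
def IsJohn {N : ℕ} (b₀ : ℝ) (G : Set (Euc N)) : Prop :=
  ∀ a ∈ G, ∀ b ∈ G, a ≠ b → ∃ γ : ℝ → Euc N,
    ContinuousOn γ (Icc 0 1) ∧ γ 0 = a ∧ γ 1 = b ∧ (∀ t ∈ Icc (0:ℝ) 1, γ t ∈ G) ∧
    ∀ t ∈ Icc (0:ℝ) 1, b₀⁻¹ * min (dist (γ t) a) (dist (γ t) b) ≤ infDist (γ t) (frontier G)

/-- `(θ, a)`-uniform interior cone condition. -/
def UnifConeCond {N : ℕ} (θ a : ℝ) (G : Set (Euc N)) : Prop :=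
  ∀ x ∈ frontier G, ∃ ω : Euc N, ‖ω‖ = 1 ∧
    ∀ w ∈ ball x a ∩ closure G, ∀ y : Euc N,
      ⟪y, ω⟫ > ‖y‖ * Real.cos θ → ‖y‖ < a → w + y ∈ G

/-- `r`-uniform interior sphere condition. -/
def IntSphere {N : ℕ} (r : ℝ) (Ω : Set (Euc N)) : Prop :=
  ∀ x ∈ frontier Ω, ∃ c : Euc N, ball c r ⊆ Ω ∧ dist x c = r

/-- `r`-uniform exterior sphere condition. -/
def ExtSphere {N : ℕ} (r : ℝ) (Ω : Set (Euc N)) : Prop :=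
  ∀ x ∈ frontier Ω, ∃ c : Euc N, ball c r ⊆ (closure Ω)ᶜ ∧ dist x c = r

open Topology Filter in
theorem contDiffAt_fderiv_apply {N : ℕ} {f : Euc N → ℝ} {x : Euc N} (hf : ContDiffAt ℝ 2 f x)
    (e : Euc N) : ContDiffAt ℝ 1 (fun y => fderiv ℝ f y e) x :=
  (hf.fderiv_right (m := 1) (by norm_num)).clm_apply contDiffAt_const

open Topology Filter in
theorem fderiv_affine_quad {N : ℕ} {u : Euc N → ℝ} {x : Euc N} (hu : DifferentiableAt ℝ u x)
    (b c k : ℝ) (z : Euc N) (e : Euc N) :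
    fderiv ℝ (fun y => b * u y + c * (‖y - z‖ ^ 2 / 2) + k) x e
      = b * fderiv ℝ u x e + c * ⟪x - z, e⟫ := by
  have h1 : HasFDerivAt (fun y : Euc N => ‖y - z‖ ^ 2)
      (2 • (innerSL ℝ (x - z)).comp (ContinuousLinearMap.id ℝ (Euc N))) x :=
    ((hasFDerivAt_id x).sub_const z).norm_sq
  have h2 := (((hu.hasFDerivAt.const_mul b).add (h1.const_mul (c / 2))).add_const k).fderiv
  have h3 := congrArg (fun L : Euc N →L[ℝ] ℝ => L e) h2
  convert h3 using 1
  · congr 2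
    ext y
    simp
    ring
  · simp [inner_sub_left]
    ring

open Topology Filter in
theorem hessEntry_affine_quad {N : ℕ} {u : Euc N → ℝ} {x : Euc N} (hu : ContDiffAt ℝ 2 u x)
    (b c k : ℝ) (z : Euc N) (i j : Fin N) :
    hessEntry (fun y => b * u y + c * (‖y - z‖ ^ 2 / 2) + k) x i j
      = b * hessEntry u x i j + c * (if i = j then 1 else 0) := by
  unfold hessEntry
  have hev : (fun y => fderiv ℝ (fun y => b * u y + c * (‖y - z‖ ^ 2 / 2) + k) y
      (EuclideanSpace.single j (1 : ℝ))) =ᶠ[𝓝 x]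
      fun y => b * fderiv ℝ u y (EuclideanSpace.single j 1)
        + c * ⟪y - z, EuclideanSpace.single j (1 : ℝ)⟫ := by
    filter_upwards [hu.eventually (by simp)] with y hy
    exact fderiv_affine_quad (hy.differentiableAt (by norm_num)) b c k z _
  rw [hev.fderiv_eq]
  have h1 : HasFDerivAt (fun y : Euc N => ⟪y - z, EuclideanSpace.single j (1 : ℝ)⟫)
      (innerSL ℝ (EuclideanSpace.single j (1 : ℝ))) x := by
    have := (innerSL ℝ (EuclideanSpace.single j (1 : ℝ) : Euc N)).hasFDerivAt.comp x
      ((hasFDerivAt_id x).sub_const z)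
    refine (this.congr_fderiv (by ext; simp)).congr_of_eventuallyEq (Eventually.of_forall ?_)
    intro y
    simp [real_inner_comm]
  have h2 := (((contDiffAt_fderiv_apply hu (EuclideanSpace.single j 1)).differentiableAt
    (by norm_num)).hasFDerivAt.const_mul b).add (h1.const_mul c)
  have h3 := congrArg (fun L : Euc N →L[ℝ] ℝ => L (EuclideanSpace.single i 1)) h2.fderiv
  refine h3.trans ?_
  rcases eq_or_ne i j with rfl | hij
  · simp
  · simp [EuclideanSpace.inner_single_left, hij.symm, hij]

open Topology Filter in
theorem lap_affine_quad {N : ℕ} {u : Euc N → ℝ} {x : Euc N} (hu : ContDiffAt ℝ 2 u x)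
    (b c k : ℝ) (z : Euc N) :
    lap (fun y => b * u y + c * (‖y - z‖ ^ 2 / 2) + k) x = b * lap u x + c * N := by
  simp only [lap, hessEntry_affine_quad hu, if_true, Finset.sum_add_distrib, Finset.mul_sum]
  simp [mul_comm]

open Topology Filter in
theorem lap_nonpos_of_isLocalMax {N : ℕ} {f : Euc N → ℝ} {x : Euc N} (hf : ContDiffAt ℝ 2 f x)
    (hmax : IsLocalMax f x) : lap f x ≤ 0 := by
  by_contra! hpos
  obtain ⟨i, -, hi⟩ : ∃ i ∈ Finset.univ, 0 < hessEntry f x i i := by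
    by_contra! hcon
    exact absurd (Finset.sum_nonpos hcon) (not_le.2 hpos)
  set e : Euc N := EuclideanSpace.single i 1 with he
  have hline : ∀ t : ℝ, HasDerivAt (fun t : ℝ => x + t • e) e t := fun t => by
    simpa using ((hasDerivAt_id t).smul_const e).const_add x
  have hc0 : Tendsto (fun t : ℝ => x + t • e) (𝓝 0) (𝓝 x) := by
    simpa using (hline 0).continuousAt.tendsto
  set φ : ℝ → ℝ := fun t => f (x + t • e) with hφ
  have hd : deriv φ =ᶠ[𝓝 0] fun t => fderiv ℝ f (x + t • e) e := by
    filter_upwards [hc0.eventually (hf.eventually (by simp))] with t ht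
    exact ((ht.differentiableAt (by norm_num)).hasFDerivAt.comp_hasDerivAt t (hline t)).deriv
  have hdd : deriv (deriv φ) 0 = hessEntry f x i i := by
    rw [hd.deriv_eq]
    have h1 : HasFDerivAt (fun y => fderiv ℝ f y e) (fderiv ℝ (fun y => fderiv ℝ f y e) x)
        (x + (0 : ℝ) • e) := by
      simpa using ((contDiffAt_fderiv_apply hf e).differentiableAt (by norm_num)).hasFDerivAt
    exact (h1.comp_hasDerivAt (0 : ℝ) (hline 0)).deriv
  have hmaxφ : IsLocalMax φ 0 := by
    have : ∀ᶠ y in 𝓝 x, f y ≤ f x := hmax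
    filter_upwards [hc0.eventually this] with t ht
    simpa [hφ] using ht
  have hcφ : ContinuousAt φ 0 := by
    refine ContinuousAt.comp (g := f) ?_ (hline 0).continuousAt
    simpa using hf.continuousAt
  have hminφ := isLocalMin_of_deriv_deriv_pos (by rw [hdd]; exact hi) hmaxφ.deriv_eq_zero hcφ
  have hconst : φ =ᶠ[𝓝 0] fun _ => φ 0 := by
    filter_upwards [hmaxφ, hminφ] with t h1 h2 using le_antisymm h1 h2
  have h0 := hconst.deriv.deriv_eq
  rw [hdd] at h0
  simp at h0
  exact hi.ne' h0

open Topology Filter in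
/-- Weak maximum principle for strictly subharmonic functions. -/
theorem neg_of_lap_pos {N : ℕ} {U : Set (Euc N)} (hU : IsOpen U) (hb : Bornology.IsBounded U)
    {f : Euc N → ℝ} (hc : ContinuousOn f (closure U)) (hf : ContDiffOn ℝ 2 f U)
    (hl : ∀ x ∈ U, 0 < lap f x) (hfr : ∀ x ∈ frontier U, f x ≤ 0) : ∀ x ∈ U, f x < 0 := by
  intro x hx
  have hK : IsCompact (closure U) := hb.isCompact_closure
  obtain ⟨p, hp, hmax⟩ := hK.exists_isMaxOn ⟨x, subset_closure hx⟩ hc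
  have hnot : ∀ q ∈ U, ¬ IsMaxOn f (closure U) q := by
    intro q hq hm
    have hloc : IsLocalMax f q :=
      (hm.on_subset subset_closure).isLocalMax (hU.mem_nhds hq)
    exact absurd (lap_nonpos_of_isLocalMax (hf.contDiffAt (hU.mem_nhds hq)) hloc)
      (not_le.2 (hl q hq))
  have hpf : p ∈ frontier U := by
    rw [hU.frontier_eq]
    exact ⟨hp, fun h => hnot p h hmax⟩
  have hle : ∀ y ∈ closure U, f y ≤ 0 := fun y hy => (hmax hy).trans (hfr p hpf)
  refine lt_of_le_of_ne (hle x (subset_closure hx)) fun h0 => hnot x hx ?_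
  intro y hy
  simpa [h0] using hle y hy

theorem IsTorsion.neg {N : ℕ} (hN : 0 < N) {Ω : Set (Euc N)} (hΩ : IsOpen Ω)
    (hb : Bornology.IsBounded Ω) {u : Euc N → ℝ} (hu : IsTorsion Ω u) : ∀ x ∈ Ω, u x < 0 :=
  neg_of_lap_pos hΩ hb hu.1 hu.2.1 (fun x hx => by rw [hu.2.2.1 x hx]; exact_mod_cast hN)
    (fun x hx => (hu.2.2.2 x hx).le)

theorem IsTorsion.le_of_ball_subset {N : ℕ} (hN : 0 < N) {Ω : Set (Euc N)} (hΩ : IsOpen Ω)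
    (hb : Bornology.IsBounded Ω) {u : Euc N → ℝ} (hu : IsTorsion Ω u) {x : Euc N} {r : ℝ}
    (hr : 0 < r) (hx : ball x r ⊆ Ω) : u x ≤ -(r ^ 2 / 2) := by
  have key : ∀ ε ∈ Ioo (0 : ℝ) 1, u x ≤ -((1 - ε) * (r ^ 2 / 2)) := by
    intro ε hε
    have hcl : closure (ball x r) ⊆ closure Ω := closure_mono hx
    have hneg : ∀ y ∈ closure Ω, u y ≤ 0 := by
      intro y hy
      by_cases hyΩ : y ∈ Ω
      · exact (hu.neg hN hΩ hb y hyΩ).le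
      · exact (hu.2.2.2 y (by rw [hΩ.frontier_eq]; exact ⟨hy, hyΩ⟩)).le
    have h := neg_of_lap_pos (U := ball x r) isOpen_ball isBounded_ball
      (f := fun y => 1 * u y + (-(1 - ε)) * (‖y - x‖ ^ 2 / 2) + (1 - ε) * (r ^ 2 / 2)) ?_ ?_ ?_ ?_
      x (mem_ball_self hr)
    · simp at h
      linarith
    · have := hu.1.mono hcl
      fun_prop
    · have := hu.2.1.mono hx
      have h2 : ContDiff ℝ 2 (fun y : Euc N => ‖y - x‖ ^ 2) :=
        (contDiff_id.sub contDiff_const).norm_sq ℝ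
      exact ((contDiffOn_const.mul this).add
        (contDiffOn_const.mul (h2.contDiffOn.div_const 2))).add contDiffOn_const
    · intro y hy
      rw [lap_affine_quad (hu.2.1.contDiffAt (hΩ.mem_nhds (hx hy))), hu.2.2.1 y (hx hy)]
      have : (0 : ℝ) < N := by exact_mod_cast hN
      nlinarith [hε.1]
    · intro y hy
      have h1 : ‖y - x‖ = r := by
        rw [frontier_ball x hr.ne'] at hy
        simpa [dist_eq_norm] using hy
      have h2 := hneg y (hcl (frontier_subset_closure hy))
      simp only [h1]
      linarith
  by_contra! hcon
  have hr2 : 0 < r ^ 2 / 2 := by positivity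
  set s := u x + r ^ 2 / 2 with hs
  have hs0 : 0 < s := by linarith
  have := key (min (1 / 2) (s / (r ^ 2))) ⟨by positivity, by
    exact (min_le_left _ _).trans_lt (by norm_num)⟩
  have h3 : min (1 / 2) (s / (r ^ 2)) * (r ^ 2 / 2) ≤ s / 2 := by
    calc _ ≤ s / r ^ 2 * (r ^ 2 / 2) := by gcongr; exact min_le_right _ _
      _ = s / 2 := by field_simp
  linarith

theorem enorm_sub_le_lintegral_fderiv {N : ℕ} {Ω : Set (Euc N)} (hΩ : IsOpen Ω) {F : Euc N → ℝ}
    (hF : ContDiffOn ℝ 1 F Ω) {w e : Euc N} {L : ℝ} (hL : 0 ≤ L)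
    (hseg : ∀ t ∈ Icc 0 L, w + t • e ∈ Ω) :
    ‖F (w + L • e) - F w‖ₑ ≤ ∫⁻ t in Icc 0 L, ‖fderiv ℝ F (w + t • e)‖ₑ * ‖e‖ₑ := by
  have hline : ∀ t : ℝ, HasDerivAt (fun t : ℝ => w + t • e) e t := fun t => by
    simpa using ((hasDerivAt_id t).smul_const e).const_add w
  have hd : ∀ t ∈ uIcc 0 L, HasDerivAt (fun t => F (w + t • e)) (fderiv ℝ F (w + t • e) e) t := by
    intro t ht
    rw [uIcc_of_le hL] at ht
    exact ((hF.contDiffAt (hΩ.mem_nhds (hseg t ht))).differentiableAt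
      (by norm_num)).hasFDerivAt.comp_hasDerivAt t (hline t)
  have hcont : ContinuousOn (fun t => fderiv ℝ F (w + t • e) e) (uIcc 0 L) := by
    rw [uIcc_of_le hL]
    have h1 : ContinuousOn (fderiv ℝ F) Ω := hF.continuousOn_fderiv_of_isOpen hΩ (by norm_num)
    have h2 : ContinuousOn (fun t : ℝ => w + t • e) (Icc 0 L) := by fun_prop
    exact (h1.comp h2 hseg).clm_apply continuousOn_const
  have hFTC := intervalIntegral.integral_eq_sub_of_hasDerivAt hd hcont.intervalIntegrable
  simp only [zero_smul, add_zero] at hFTC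
  rw [← hFTC, intervalIntegral.integral_of_le hL, ← integral_Icc_eq_integral_Ioc]
  refine (enorm_integral_le_lintegral_enorm _).trans (lintegral_mono fun t => ?_)
  exact (fderiv ℝ F (w + t • e)).le_opENorm e

theorem setLIntegral_line_eq {N : ℕ} {A : Set (Euc N)} (hA : MeasurableSet A)
    {q : Euc N → ENNReal} (hq : Measurable q) (e : Euc N) (L : ℝ) :
    ∫⁻ w in A, ∫⁻ t in Icc 0 L, q (w + t • e)
      = ∫⁻ y, q y * volume {t : ℝ | t ∈ Icc 0 L ∧ y - t • e ∈ A} := by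
  have hm : Measurable (fun p : Euc N × ℝ => p.1 + p.2 • e) := by fun_prop
  have hm' : Measurable (fun p : ℝ × Euc N => p.2 - p.1 • e) := by fun_prop
  rw [← lintegral_indicator hA]
  have h1 : ∀ w, A.indicator (fun w => ∫⁻ t in Icc 0 L, q (w + t • e)) w
      = ∫⁻ t in Icc 0 L, A.indicator 1 w * q (w + t • e) := by
    intro w
    by_cases hw : w ∈ A <;> simp [hw]
  simp_rw [h1]
  rw [lintegral_lintegral_swap]
  · have h2 : ∀ t : ℝ, ∫⁻ w, A.indicator 1 w * q (w + t • e)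
        = ∫⁻ y, A.indicator 1 (y - t • e) * q y := by
      intro t
      rw [← lintegral_add_right_eq_self (fun y => A.indicator 1 (y - t • e) * q y) (t • e)]
      simp
    simp_rw [h2]
    rw [lintegral_lintegral_swap]
    · refine lintegral_congr fun y => ?_
      have hmy : Measurable fun t : ℝ => y - t • e := by fun_prop
      have hmi : Measurable fun t : ℝ => A.indicator (1 : Euc N → ENNReal) (y - t • e) :=
        (measurable_one.indicator hA).comp hmy
      rw [lintegral_mul_const _ hmi, mul_comm]
      congr 1
      have h3 : (fun t : ℝ => A.indicator (1 : Euc N → ENNReal) (y - t • e))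
          = ((fun t : ℝ => y - t • e) ⁻¹' A).indicator 1 := by
        rfl
      rw [h3, lintegral_indicator_one (hmy hA), Measure.restrict_apply (hmy hA)]
      congr 1
      ext t
      simp [and_comm]
    · exact ((((measurable_one.indicator hA).comp hm').mul
        (hq.comp measurable_snd))).aemeasurable
  · exact (((measurable_one.indicator hA).comp measurable_fst).mul (hq.comp hm)).aemeasurable

theorem sq_lintegral_unit_le {q : ℝ → ENNReal} (hq : Measurable q) :
    (∫⁻ t in Icc (0 : ℝ) 1, q t) ^ 2 ≤ ∫⁻ t in Icc (0 : ℝ) 1, q t ^ 2 := by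
  have h := ENNReal.lintegral_mul_le_Lp_mul_Lq (volume.restrict (Icc (0 : ℝ) 1))
    Real.HolderConjugate.two_two hq.aemeasurable (g := 1) aemeasurable_const
  simp only [Pi.mul_apply, Pi.one_apply, mul_one, lintegral_const,
    Measure.restrict_apply_univ, Real.volume_Icc, sub_zero, ENNReal.ofReal_one,
    ENNReal.rpow_two, one_pow, ENNReal.one_rpow] at h
  calc _ ≤ ((∫⁻ t in Icc (0 : ℝ) 1, q t ^ 2) ^ (1 / 2 : ℝ)) ^ 2 := by gcongr
    _ = _ := by
      rw [← ENNReal.rpow_natCast, ← ENNReal.rpow_mul]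
      norm_num

/-- Poincaré inequality on a bounded convex open set. -/
theorem exists_lintegral_sub_sq_le_of_convex {N : ℕ} {U : Set (Euc N)} (hU : IsOpen U)
    (hconv : Convex ℝ U) {s : ℝ} (hs : ∀ x ∈ U, ∀ y ∈ U, ‖y - x‖ ≤ s)
    (hne : U.Nonempty) {v : Euc N → ℝ} (hvm : Measurable v)
    (hv : ContDiffOn ℝ 1 v U) :
    ∃ c, ∫⁻ x in U, ‖v x - c‖ₑ ^ 2 ≤
      ENNReal.ofReal s ^ 2 * volume (closedBall (0 : Euc N) s) / volume U
        * ∫⁻ x in U, ‖fderiv ℝ v x‖ₑ ^ 2 := by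
  set D := ∫⁻ x in U, ‖fderiv ℝ v x‖ₑ ^ 2 with hD
  set q : Euc N → ENNReal := U.indicator fun x => ‖fderiv ℝ v x‖ₑ ^ 2 with hq
  have hqm : Measurable q := ((measurable_fderiv ℝ v).enorm.pow_const 2).indicator hU.measurableSet
  have hqD : ∫⁻ x, q x = D := lintegral_indicator hU.measurableSet _
  have hpair : ∀ x ∈ U, ∀ y ∈ U, ‖v y - v x‖ₑ ^ 2 ≤
      ENNReal.ofReal s ^ 2 * ∫⁻ t in Icc (0 : ℝ) 1, q (x + t • (y - x)) := by
    intro x hx y hy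
    have hseg : ∀ t ∈ Icc (0 : ℝ) 1, x + t • (y - x) ∈ U := fun t ht =>
      hconv.add_smul_sub_mem hx hy ht
    have h1 := enorm_sub_le_lintegral_fderiv hU hv zero_le_one hseg
    rw [one_smul, add_sub_cancel] at h1
    have hm : Measurable fun t : ℝ => x + t • (y - x) := by fun_prop
    have hmq : Measurable fun t : ℝ => ‖fderiv ℝ v (x + t • (y - x))‖ₑ :=
      ((measurable_fderiv ℝ v).comp hm).enorm
    rw [lintegral_mul_const _ hmq] at h1
    have h2 : ‖y - x‖ₑ ≤ ENNReal.ofReal s := by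
      rw [← ofReal_norm]
      exact ENNReal.ofReal_le_ofReal (hs x hx y hy)
    calc ‖v y - v x‖ₑ ^ 2
        ≤ ((∫⁻ t in Icc (0 : ℝ) 1, ‖fderiv ℝ v (x + t • (y - x))‖ₑ) * ENNReal.ofReal s) ^ 2 := by
          gcongr; exact h1.trans (by gcongr)
      _ = ENNReal.ofReal s ^ 2 * (∫⁻ t in Icc (0 : ℝ) 1, ‖fderiv ℝ v (x + t • (y - x))‖ₑ) ^ 2 := by
          ring
      _ ≤ ENNReal.ofReal s ^ 2 * ∫⁻ t in Icc (0 : ℝ) 1, ‖fderiv ℝ v (x + t • (y - x))‖ₑ ^ 2 := by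
          gcongr; exact sq_lintegral_unit_le hmq
      _ = _ := by
          congr 1
          refine setLIntegral_congr_fun measurableSet_Icc fun t ht => ?_
          simp [hq, hseg t ht]
  have hdouble : ∫⁻ x in U, ∫⁻ y in U, ‖v y - v x‖ₑ ^ 2 ≤
      ENNReal.ofReal s ^ 2 * volume (closedBall (0 : Euc N) s) * D := by
    have hB : MeasurableSet (closedBall (0 : Euc N) s) := measurableSet_closedBall
    have h3 : ∀ x ∈ U, ∫⁻ y in U, ‖v y - v x‖ₑ ^ 2 ≤ ∫⁻ e in closedBall (0 : Euc N) s,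
        ENNReal.ofReal s ^ 2 * ∫⁻ t in Icc (0 : ℝ) 1, q (x + t • e) := by
      intro x hx
      rw [← lintegral_indicator hU.measurableSet, ← lintegral_indicator hB,
        ← lintegral_add_left_eq_self _ x]
      refine lintegral_mono fun e => ?_
      by_cases hxe : x + e ∈ U
      · have he : e ∈ closedBall (0 : Euc N) s := by
          simpa using hs x hx _ hxe
        simpa [hxe, he] using hpair x hx _ hxe
      · simp [hxe]
    have hmm : Measurable fun p : (Euc N × Euc N) × ℝ => q (p.1.1 + p.2 • p.1.2) :=
      hqm.comp (by fun_prop)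
    calc _ ≤ ∫⁻ x in U, ∫⁻ e in closedBall (0 : Euc N) s,
          ENNReal.ofReal s ^ 2 * ∫⁻ t in Icc (0 : ℝ) 1, q (x + t • e) :=
          setLIntegral_mono' hU.measurableSet h3
      _ ≤ ∫⁻ x, ∫⁻ e in closedBall (0 : Euc N) s,
          ENNReal.ofReal s ^ 2 * ∫⁻ t in Icc (0 : ℝ) 1, q (x + t • e) :=
          setLIntegral_le_lintegral _ _
      _ = ∫⁻ e in closedBall (0 : Euc N) s, ∫⁻ x,
          ENNReal.ofReal s ^ 2 * ∫⁻ t in Icc (0 : ℝ) 1, q (x + t • e) := by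
          rw [lintegral_lintegral_swap]
          exact (hmm.lintegral_prod_right'.const_mul _).aemeasurable
      _ = ∫⁻ e in closedBall (0 : Euc N) s, ENNReal.ofReal s ^ 2 * D := by
          refine lintegral_congr fun e => ?_
          have hm2 : Measurable fun p : Euc N × ℝ => q (p.1 + p.2 • e) := hqm.comp (by fun_prop)
          rw [lintegral_const_mul _ hm2.lintegral_prod_right',
            lintegral_lintegral_swap hm2.aemeasurable]
          simp [lintegral_add_right_eq_self, hqD]
      _ = _ := by
          simp
          ring
  have hvol0 : volume U ≠ 0 := (hU.measure_pos volume hne).ne'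
  have hvolT : volume U ≠ ⊤ := by
    obtain ⟨x0, hx0⟩ := hne
    refine (Bornology.IsBounded.subset (isBounded_closedBall (x := x0) (r := s)) ?_).measure_lt_top.ne
    intro y hy
    simpa [dist_eq_norm] using hs x0 hx0 y hy
  have hmeas : Measurable fun x => ∫⁻ y in U, ‖v y - v x‖ₑ ^ 2 := by
    have : Measurable fun p : Euc N × Euc N => ‖v p.2 - v p.1‖ₑ ^ 2 :=
      ((hvm.comp measurable_snd).sub (hvm.comp measurable_fst)).enorm.pow_const 2
    exact this.lintegral_prod_right'
  obtain ⟨x0, -, hx0⟩ := exists_le_setLAverage hvol0 hvolT hmeas.aemeasurable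
  refine ⟨v x0, hx0.trans ?_⟩
  rw [setLAverage_eq]
  calc _ ≤ (ENNReal.ofReal s ^ 2 * volume (closedBall (0 : Euc N) s) * D) / volume U := by gcongr
    _ = _ := by rw [div_eq_mul_inv, div_eq_mul_inv]; ring

/-- The open `ρ`-neighbourhood of the segment `{p + s • ω | α ≤ s ≤ β}`. -/
def capsule {N : ℕ} (p ω : Euc N) (ρ α β : ℝ) : Set (Euc N) :=
  {w | ∃ s ∈ Icc α β, ‖w - (p + s • ω)‖ < ρ}

theorem isOpen_capsule {N : ℕ} (p ω : Euc N) (ρ α β : ℝ) : IsOpen (capsule p ω ρ α β) := by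
  have : capsule p ω ρ α β = ⋃ s ∈ Icc α β, ball (p + s • ω) ρ := by
    ext w; simp [capsule, dist_eq_norm]
  rw [this]
  exact isOpen_biUnion fun _ _ => isOpen_ball

theorem convex_capsule {N : ℕ} (p ω : Euc N) (ρ α β : ℝ) : Convex ℝ (capsule p ω ρ α β) := by
  rintro x ⟨s, hs, hx⟩ y ⟨t, ht, hy⟩ a b ha hb hab
  refine ⟨a * s + b * t, (convex_Icc α β) hs ht ha hb hab, ?_⟩
  have h1 : a • x + b • y - (p + (a * s + b * t) • ω)
      = a • (x - (p + s • ω)) + b • (y - (p + t • ω)) := by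
    have : p = (a + b) • p := by rw [hab, one_smul]
    conv_lhs => rw [this]
    module
  rw [h1]
  have := (convex_ball (0 : Euc N) ρ) (mem_ball_zero_iff.2 hx) (mem_ball_zero_iff.2 hy) ha hb hab
  simpa using this

theorem norm_sub_le_of_mem_capsule {N : ℕ} {p ω : Euc N} (hω : ‖ω‖ = 1) {ρ α β : ℝ}
    {x y : Euc N} (hx : x ∈ capsule p ω ρ α β) (hy : y ∈ capsule p ω ρ α β) :
    ‖y - x‖ ≤ β - α + 2 * ρ := by
  obtain ⟨s, hs, hx⟩ := hx
  obtain ⟨t, ht, hy⟩ := hy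
  have h1 : y - x = (y - (p + t • ω)) - (x - (p + s • ω)) + (t - s) • ω := by module
  have h2 : ‖(t - s) • ω‖ ≤ β - α := by
    rw [norm_smul, hω, mul_one, Real.norm_eq_abs, abs_le]
    constructor <;> linarith [hs.1, hs.2, ht.1, ht.2]
  rw [h1]
  linarith [norm_add_le ((y - (p + t • ω)) - (x - (p + s • ω))) ((t - s) • ω),
    norm_sub_le (y - (p + t • ω)) (x - (p + s • ω))]

/-- Local weighted Poincaré inequality near a point where the cone condition holds. -/
theorem exists_local_weighted_poincare (N : ℕ) {κ ℓ : ℝ} (hκ : 0 < κ) (hκ1 : κ ≤ 1) (hℓ : 0 < ℓ) :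
    ∃ C : ENNReal, C ≠ ⊤ ∧ ∀ Ω : Set (Euc N), IsOpen Ω → Bornology.IsBounded Ω →
      ∀ W : Euc N → ℝ, (∀ x r, 0 < r → ball x r ⊆ Ω → r ^ 2 ≤ W x) →
      ∀ p ∈ Ω, ∀ ω : Euc N, ‖ω‖ = 1 →
      (∀ w ∈ Ω, ‖w - p‖ < 3 * ℓ → ∀ t ∈ Ioc 0 (2 * ℓ), ball (w + t • ω) (κ * t) ⊆ Ω) →
      ∀ v : Euc N → ℝ, Measurable v → ContDiffOn ℝ 1 v Ω → (∃ M, ∀ x ∈ Ω, |v x| ≤ M) →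
      ∃ c : ℝ, ∫⁻ x in Ω ∩ ball p (κ * ℓ / 2), ‖v x - c‖ₑ ^ 2 ≤
        C * ∫⁻ x in Ω, ENNReal.ofReal (W x) * ‖fderiv ℝ v x‖ₑ ^ 2 := by
  set ρ := κ * ℓ / 2 with hρ
  have hρ0 : 0 < ρ := by positivity
  have hρℓ : 2 * ρ ≤ ℓ := by rw [hρ]; nlinarith
  set C₁ : ENNReal := ENNReal.ofReal (2 * ℓ) ^ 2 * volume (closedBall (0 : Euc N) (2 * ℓ))
    / volume (ball (0 : Euc N) ρ) with hC₁
  have hC₁t : C₁ ≠ ⊤ := by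
    refine ENNReal.div_ne_top
      (ENNReal.mul_ne_top (ENNReal.pow_ne_top ENNReal.ofReal_ne_top) measure_closedBall_lt_top.ne) ?_
    exact (measure_ball_pos volume _ hρ0).ne'
  refine ⟨3 * (C₁ * (ENNReal.ofReal (ρ ^ 2))⁻¹) + 2 * ENNReal.ofReal (2 / κ ^ 2), ?_, ?_⟩
  · have : (ENNReal.ofReal (ρ ^ 2))⁻¹ ≠ ⊤ := by simp; positivity
    finiteness
  intro Ω hΩ hΩb W hW p hp ω hω hloc v hvm hv hvb
  set D := ∫⁻ x in Ω, ENNReal.ofReal (W x) * ‖fderiv ℝ v x‖ₑ ^ 2 with hD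
  set A := Ω ∩ capsule p ω ρ 0 ℓ with hA
  set U := capsule p ω ρ ℓ (2 * ℓ) with hU
  have hUo : IsOpen U := isOpen_capsule _ _ _ _ _
  have hAo : IsOpen A := hΩ.inter (isOpen_capsule _ _ _ _ _)
  have hUball : ∀ y ∈ U, ball y ρ ⊆ Ω := by
    rintro y ⟨s, hs, hy⟩ z hz
    refine hloc p hp (by simpa using hℓ) s ⟨by linarith [hs.1], hs.2⟩ ?_
    rw [mem_ball, dist_eq_norm] at hz ⊢
    have : z - (p + s • ω) = (z - y) + (y - (p + s • ω)) := by abel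
    rw [this]
    have h2 : κ * ℓ ≤ κ * s := by gcongr; exact hs.1
    linarith [norm_add_le (z - y) (y - (p + s • ω))]
  have hUΩ : U ⊆ Ω := fun y hy => hUball y hy (mem_ball_self hρ0)
  have hAnorm : ∀ w ∈ A, ‖w - p‖ < 3 * ℓ := by
    rintro w ⟨-, s, hs, hw⟩
    have h1 : w - p = (w - (p + s • ω)) + s • ω := by abel
    have h2 : ‖s • ω‖ ≤ ℓ := by
      rw [norm_smul, hω, mul_one, Real.norm_eq_abs, abs_of_nonneg hs.1]; exact hs.2
    rw [h1]
    linarith [norm_add_le (w - (p + s • ω)) (s • ω)]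
  have hAball : ∀ w ∈ A, ∀ t ∈ Ioc 0 ℓ, ball (w + t • ω) (κ * t) ⊆ Ω := fun w hw t ht =>
    hloc w hw.1 (hAnorm w hw) t ⟨ht.1, by linarith [ht.2]⟩
  have hAU : ∀ w ∈ A, ∀ t ∈ Icc 0 ℓ, w + t • ω ∈ A ∪ U := by
    intro w hw t ht
    rcases ht.1.eq_or_lt with h0 | h0
    · left; simpa [← h0] using hw
    have hmem : w + t • ω ∈ Ω := hAball w hw t ⟨h0, ht.2⟩ (mem_ball_self (by positivity))
    obtain ⟨-, s, hs, hws⟩ := hw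
    have hn : ‖w + t • ω - (p + (s + t) • ω)‖ < ρ := by
      have : w + t • ω - (p + (s + t) • ω) = w - (p + s • ω) := by module
      rwa [this]
    by_cases hst : s + t ≤ ℓ
    · exact Or.inl ⟨hmem, s + t, ⟨by linarith [hs.1], hst⟩, hn⟩
    · exact Or.inr ⟨s + t, ⟨by linarith, by linarith [hs.2, ht.2]⟩, hn⟩
  have hTΩ : A ∪ U ⊆ Ω := union_subset inter_subset_left hUΩ
  have hAL : ∀ w ∈ A, w + ℓ • ω ∈ U := by
    rintro w ⟨-, s, hs, hws⟩
    refine ⟨s + ℓ, ⟨by linarith [hs.1], by linarith [hs.2]⟩, ?_⟩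
    have : w + ℓ • ω - (p + (s + ℓ) • ω) = w - (p + s • ω) := by module
    rwa [this]
  have hUne : U.Nonempty := ⟨p + ℓ • ω, ℓ, ⟨le_rfl, by linarith⟩, by simpa using hρ0⟩
  obtain ⟨c, hc⟩ := exists_lintegral_sub_sq_le_of_convex hUo (convex_capsule _ _ _ _ _)
    (s := 2 * ℓ) (fun x hx y hy => (norm_sub_le_of_mem_capsule hω hx hy).trans (by linarith))
    hUne hvm (hv.mono hUΩ)
  refine ⟨c, ?_⟩
  set X := ∫⁻ x in A, ‖v x - c‖ₑ ^ 2 with hX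
  set Y := ∫⁻ x in U, ‖v x - c‖ₑ ^ 2 with hY
  have hYD : Y ≤ C₁ * (ENNReal.ofReal (ρ ^ 2))⁻¹ * D := by
    have hvol : volume (ball (0 : Euc N) ρ) ≤ volume U := by
      rw [← Measure.addHaar_ball_center volume (p + ℓ • ω)]
      refine measure_mono fun y hy => ⟨ℓ, ⟨le_rfl, by linarith⟩, ?_⟩
      simpa [dist_eq_norm] using hy
    have hDU : ∫⁻ x in U, ‖fderiv ℝ v x‖ₑ ^ 2 ≤ (ENNReal.ofReal (ρ ^ 2))⁻¹ * D := by
      rw [mul_comm, ← div_eq_mul_inv, ENNReal.le_div_iff_mul_le (by left; simp; positivity)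
        (by left; simp), mul_comm, ← lintegral_const_mul' _ _ (by simp)]
      calc _ ≤ ∫⁻ x in U, ENNReal.ofReal (W x) * ‖fderiv ℝ v x‖ₑ ^ 2 := by
            refine setLIntegral_mono' hUo.measurableSet fun x hx => ?_
            gcongr
            exact hW x ρ hρ0 (hUball x hx)
        _ ≤ D := lintegral_mono_set hUΩ
    calc Y ≤ _ := hc
      _ ≤ C₁ * ((ENNReal.ofReal (ρ ^ 2))⁻¹ * D) := by
        rw [hC₁]
        gcongr
      _ = _ := by ring
  have hXt : X ≠ ⊤ := by
    obtain ⟨M, hM⟩ := hvb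
    have : X ≤ ∫⁻ x in A, ENNReal.ofReal (M + |c|) ^ 2 := by
      refine setLIntegral_mono' hAo.measurableSet fun x hx => ?_
      gcongr
      rw [← ofReal_norm]
      refine ENNReal.ofReal_le_ofReal ?_
      exact (norm_sub_le _ _).trans (by simpa using hM x hx.1)
    refine (this.trans_lt ?_).ne
    rw [setLIntegral_const]
    exact ENNReal.mul_lt_top (by simp) (hΩb.subset inter_subset_left).measure_lt_top
  set F : Euc N → ℝ := fun x => (v x - c) ^ 2 with hF
  have hFc : ContDiffOn ℝ 1 F Ω := (hv.sub contDiffOn_const).pow 2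
  have hT : MeasurableSet (A ∪ U) := (hAo.union hUo).measurableSet
  set q : Euc N → ENNReal := (A ∪ U).indicator fun x => ‖fderiv ℝ F x‖ₑ with hq
  have hqm : Measurable q := (measurable_fderiv ℝ F).enorm.indicator hT
  have hFe : ∀ x, ‖F x‖ₑ = ‖v x - c‖ₑ ^ 2 := fun x => by simp [hF, enorm_pow]
  have hline : ∀ w ∈ A, ‖v w - c‖ₑ ^ 2 ≤
      ‖v (w + ℓ • ω) - c‖ₑ ^ 2 + ∫⁻ t in Icc 0 ℓ, q (w + t • ω) := by
    intro w hw
    have h1 := enorm_sub_le_lintegral_fderiv hΩ hFc hℓ.le (fun t ht => hTΩ (hAU w hw t ht))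
    have h2 : ∫⁻ t in Icc 0 ℓ, ‖fderiv ℝ F (w + t • ω)‖ₑ * ‖ω‖ₑ
        = ∫⁻ t in Icc 0 ℓ, q (w + t • ω) := by
      refine setLIntegral_congr_fun measurableSet_Icc fun t ht => ?_
      have hω' : ‖ω‖ₑ = 1 := by rw [← ofReal_norm, hω, ENNReal.ofReal_one]
      simp only [hq, indicator_of_mem (hAU w hw t ht), hω', mul_one]
    rw [h2] at h1
    rw [← hFe, ← hFe]
    have h3 : F w = F (w + ℓ • ω) - (F (w + ℓ • ω) - F w) := by ring
    calc ‖F w‖ₑ = ‖F (w + ℓ • ω) - (F (w + ℓ • ω) - F w)‖ₑ := by rw [← h3]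
      _ ≤ ‖F (w + ℓ • ω)‖ₑ + ‖F (w + ℓ • ω) - F w‖ₑ := enorm_sub_le
      _ ≤ _ := by gcongr
  have hpt : ∀ y ∈ A ∪ U, q y * volume {t : ℝ | t ∈ Icc 0 ℓ ∧ y - t • ω ∈ A} ≤
      2⁻¹ * ‖v y - c‖ₑ ^ 2 + ENNReal.ofReal (2 / κ ^ 2) *
        (ENNReal.ofReal (W y) * ‖fderiv ℝ v y‖ₑ ^ 2) := by
    intro y hy
    have hyΩ := hTΩ hy
    have hW0 : 0 ≤ W y := by
      obtain ⟨ε, hε, hb⟩ := Metric.isOpen_iff.1 hΩ y hyΩ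
      exact (sq_nonneg ε).trans (hW y ε hε hb)
    have hvol : volume {t : ℝ | t ∈ Icc 0 ℓ ∧ y - t • ω ∈ A} ≤ ENNReal.ofReal (√(W y) / κ) := by
      calc _ ≤ volume (Icc 0 (√(W y) / κ)) := by
            refine measure_mono fun t ht => ⟨ht.1.1, ?_⟩
            rcases ht.1.1.eq_or_lt with h0 | h0
            · rw [← h0]; positivity
            have hb := hAball _ ht.2 t ⟨h0, ht.1.2⟩
            rw [sub_add_cancel] at hb
            rw [le_div_iff₀ hκ, mul_comm]
            exact Real.le_sqrt_of_sq_le (hW y _ (by positivity) hb)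
        _ = _ := by simp
    have hdF : fderiv ℝ F y = (2 * (v y - c)) • fderiv ℝ v y := by
      have hvd : HasFDerivAt v (fderiv ℝ v y) y :=
        ((hv.contDiffAt (hΩ.mem_nhds hyΩ)).differentiableAt (by norm_num)).hasFDerivAt
      have := ((hvd.sub_const c).pow 2).fderiv
      rw [hF, this]
      simp
    have hqy : q y = ENNReal.ofReal (2 * |v y - c| * ‖fderiv ℝ v y‖) := by
      simp only [hq, indicator_of_mem hy]
      rw [hdF, ← ofReal_norm, norm_smul, norm_mul]
      simp
    calc _ ≤ ENNReal.ofReal (2 * |v y - c| * ‖fderiv ℝ v y‖) * ENNReal.ofReal (√(W y) / κ) := by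
          rw [hqy]; gcongr
      _ = ENNReal.ofReal (2 * |v y - c| * ‖fderiv ℝ v y‖ * (√(W y) / κ)) := by
          rw [← ENNReal.ofReal_mul (by positivity)]
      _ ≤ ENNReal.ofReal (2⁻¹ * |v y - c| ^ 2 + 2 / κ ^ 2 * (W y * ‖fderiv ℝ v y‖ ^ 2)) := by
          refine ENNReal.ofReal_le_ofReal ?_
          have h1 : 2 / κ ^ 2 * (W y * ‖fderiv ℝ v y‖ ^ 2)
              = 2 * (‖fderiv ℝ v y‖ * (√(W y) / κ)) ^ 2 := by
            rw [mul_pow, div_pow, Real.sq_sqrt hW0]; ring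
          rw [h1]
          nlinarith [sq_nonneg (|v y - c| - 2 * (‖fderiv ℝ v y‖ * (√(W y) / κ)))]
      _ = _ := by
          rw [ENNReal.ofReal_add (by positivity) (by positivity), ENNReal.ofReal_mul (by norm_num),
            ENNReal.ofReal_mul (by positivity), ENNReal.ofReal_mul hW0,
            ENNReal.ofReal_pow (by positivity), ENNReal.ofReal_pow (by positivity), ofReal_norm,
            ← Real.norm_eq_abs, ofReal_norm, ENNReal.ofReal_inv_of_pos (by norm_num)]
          simp
  have hmain : X ≤ Y + (2⁻¹ * (X + Y) + ENNReal.ofReal (2 / κ ^ 2) * D) := by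
    have hm1 : Measurable fun w => ‖v (w + ℓ • ω) - c‖ₑ ^ 2 :=
      ((hvm.comp (by fun_prop : Measurable fun w => w + ℓ • ω)).sub_const c).enorm.pow_const 2
    have hm2 : Measurable fun w => ‖v w - c‖ₑ ^ 2 := (hvm.sub_const c).enorm.pow_const 2
    calc X ≤ ∫⁻ w in A, (‖v (w + ℓ • ω) - c‖ₑ ^ 2 + ∫⁻ t in Icc 0 ℓ, q (w + t • ω)) :=
          setLIntegral_mono' hAo.measurableSet hline
      _ = (∫⁻ w in A, ‖v (w + ℓ • ω) - c‖ₑ ^ 2) + ∫⁻ w in A, ∫⁻ t in Icc 0 ℓ, q (w + t • ω) :=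
          lintegral_add_left hm1 _
      _ ≤ Y + ∫⁻ y, q y * volume {t : ℝ | t ∈ Icc 0 ℓ ∧ y - t • ω ∈ A} := by
          rw [setLIntegral_line_eq hAo.measurableSet hqm]
          gcongr
          rw [hY, ← lintegral_indicator hAo.measurableSet, ← lintegral_indicator hUo.measurableSet,
            ← lintegral_add_right_eq_self (U.indicator _) (ℓ • ω)]
          refine lintegral_mono fun w => ?_
          by_cases hw : w ∈ A
          · simp [hw, hAL w hw]
          · simp [hw]
      _ ≤ Y + ∫⁻ y in A ∪ U, (2⁻¹ * ‖v y - c‖ₑ ^ 2 + ENNReal.ofReal (2 / κ ^ 2) *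
            (ENNReal.ofReal (W y) * ‖fderiv ℝ v y‖ₑ ^ 2)) := by
          refine add_le_add le_rfl ?_
          rw [← lintegral_indicator hT]
          refine lintegral_mono fun y => ?_
          by_cases hy : y ∈ A ∪ U
          · rw [indicator_of_mem hy]; exact hpt y hy
          · simp only [hq, indicator_of_notMem hy, zero_mul, le_refl]
      _ ≤ _ := by
          rw [lintegral_add_left (hm2.const_mul _), lintegral_const_mul _ hm2,
            lintegral_const_mul' _ _ ENNReal.ofReal_ne_top]
          gcongr
          · exact lintegral_union_le _ _ _
          · exact lintegral_mono_set hTΩ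
  have hfin : X ≤ 3 * Y + 2 * (ENNReal.ofReal (2 / κ ^ 2) * D) := by
    have h2 : 2 * X ≤ X + (3 * Y + 2 * (ENNReal.ofReal (2 / κ ^ 2) * D)) := by
      calc 2 * X ≤ 2 * (Y + (2⁻¹ * (X + Y) + ENNReal.ofReal (2 / κ ^ 2) * D)) := by gcongr
        _ = 2 * Y + (2 * 2⁻¹) * (X + Y) + 2 * (ENNReal.ofReal (2 / κ ^ 2) * D) := by ring
        _ = _ := by
          rw [ENNReal.mul_inv_cancel (by norm_num) (by norm_num)]; ring
    rw [two_mul] at h2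
    exact (ENNReal.add_le_add_iff_left hXt).1 h2
  calc _ ≤ X := by
        refine lintegral_mono_set fun x hx => ⟨hx.1, 0, ⟨le_rfl, hℓ.le⟩, ?_⟩
        simpa [dist_eq_norm] using hx.2
    _ ≤ _ := hfin
    _ ≤ 3 * (C₁ * (ENNReal.ofReal (ρ ^ 2))⁻¹ * D) + 2 * (ENNReal.ofReal (2 / κ ^ 2) * D) := by
        gcongr
    _ = _ := by ring

/-- Near each boundary point, cones with common axis and linear opening `κ` stay inside `Ω`. -/
def BallCone {N : ℕ} (κ a : ℝ) (Ω : Set (Euc N)) : Prop :=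
  ∀ x ∈ frontier Ω, ∃ ω : Euc N, ‖ω‖ = 1 ∧
    ∀ w ∈ ball x a ∩ closure Ω, ∀ t ∈ Ioo 0 (a / 2), ball (w + t • ω) (κ * t) ⊆ Ω

theorem UnifConeCond.ballCone {N : ℕ} {θ a : ℝ} {Ω : Set (Euc N)} (hθ : θ ∈ Ioc 0 (π / 2))
    (h : UnifConeCond θ a Ω) : BallCone ((1 - cos θ) / 2) a Ω := by
  intro x hx
  obtain ⟨ω, hω, hc⟩ := h x hx
  have hc0 : 0 ≤ cos θ := cos_nonneg_of_mem_Icc ⟨by linarith [hθ.1, pi_pos], hθ.2⟩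
  refine ⟨ω, hω, fun w hw t ht y hy => ?_⟩
  set κ := (1 - cos θ) / 2 with hκ
  obtain ⟨e, rfl⟩ : ∃ e, y = w + (t • ω + e) := ⟨y - (w + t • ω), by abel⟩
  have he : ‖e‖ < κ * t := by
    rwa [mem_ball, dist_eq_norm, ← add_assoc, add_sub_cancel_left] at hy
  have hn : ‖t • ω + e‖ < (1 + κ) * t := by
    have : ‖t • ω‖ = t := by rw [norm_smul, hω, mul_one, Real.norm_of_nonneg ht.1.le]
    linarith [norm_add_le (t • ω) e]
  refine hc w hw _ ?_ ?_
  · have h1 : ⟪t • ω + e, ω⟫ = t + ⟪e, ω⟫ := by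
      rw [inner_add_left, real_inner_smul_left, real_inner_self_eq_norm_sq, hω]; ring
    have h2 : -‖e‖ ≤ ⟪e, ω⟫ := by
      have := abs_real_inner_le_norm e ω
      rw [hω, mul_one] at this
      linarith [neg_abs_le (⟪e, ω⟫)]
    have h3 : ‖t • ω + e‖ * cos θ ≤ (1 + κ) * t * cos θ := by gcongr
    have h4 : 0 ≤ t * (1 - cos θ) ^ 2 := mul_nonneg ht.1.le (sq_nonneg _)
    rw [h1]
    rw [hκ] at *
    nlinarith
  · have : κ ≤ 1 / 2 := by rw [hκ]; linarith
    nlinarith [ht.1, ht.2]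

theorem BallCone.exists_direction {N : ℕ} (hN : 0 < N) {κ a : ℝ} {Ω : Set (Euc N)} (hκ : κ ≤ 1)
    (ha : 0 < a) (h : BallCone κ a Ω) {p : Euc N} (hp : p ∈ Ω) :
    ∃ ω : Euc N, ‖ω‖ = 1 ∧ ∀ w ∈ Ω, ‖w - p‖ < 3 * (a / 16) →
      ∀ t ∈ Ioc 0 (2 * (a / 16)), ball (w + t • ω) (κ * t) ⊆ Ω := by
  by_cases hx : ∃ x ∈ frontier Ω, dist x p < a / 2
  · obtain ⟨x, hx, hxp⟩ := hx
    obtain ⟨ω, hω, hc⟩ := h x hx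
    refine ⟨ω, hω, fun w hw hwp t ht => hc w ⟨?_, subset_closure hw⟩ t ⟨ht.1, by linarith [ht.2]⟩⟩
    rw [← dist_eq_norm] at hwp
    rw [mem_ball]
    linarith [dist_triangle_right w x p]
  · push Not at hx
    have hb : ball p (a / 2) ⊆ Ω := by
      by_contra hn
      obtain ⟨y, hy1, hy2⟩ := not_subset.1 hn
      have hfr : ∀ x ∈ ball p (a / 2), x ∉ frontier Ω := fun x hx1 hx2 =>
        absurd (mem_ball.1 hx1) (not_lt.2 (hx x hx2))
      obtain ⟨x, hx1, hx2, hx3⟩ := (convex_ball p (a / 2)).isPreconnected (interior Ω) (closure Ω)ᶜ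
        isOpen_interior isClosed_closure.isOpen_compl (fun x hx1 => by
          by_cases h : x ∈ interior Ω
          · exact Or.inl h
          · exact Or.inr fun h' => hfr x hx1 ⟨h', h⟩)
        ⟨p, mem_ball_self (by linarith), by
          by_contra h
          exact hfr p (mem_ball_self (by linarith)) ⟨subset_closure hp, h⟩⟩
        ⟨y, hy1, fun h => hfr y hy1 ⟨h, fun h' => hy2 (interior_subset h')⟩⟩
      exact hx3 (interior_subset_closure hx2)
    refine ⟨EuclideanSpace.single ⟨0, hN⟩ 1, by simp, fun w hw hwp t ht => ?_⟩
    refine Subset.trans (fun y hy => ?_) hb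
    set ω : Euc N := EuclideanSpace.single ⟨0, hN⟩ 1 with hω
    have hω1 : ‖ω‖ = 1 := by simp [hω]
    rw [mem_ball, dist_eq_norm] at hy ⊢
    have h1 : y - p = (y - (w + t • ω)) + (t • ω + (w - p)) := by abel
    have h2 : ‖t • ω‖ = t := by rw [norm_smul, hω1, mul_one, Real.norm_of_nonneg ht.1.le]
    have h3 : κ * t ≤ t := by nlinarith [ht.1]
    rw [h1]
    linarith [norm_add_le (y - (w + t • ω)) (t • ω + (w - p)), norm_add_le (t • ω) (w - p), ht.2]

theorem enorm_sub_sq_le_two_mul (x y z : ℝ) :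
    ‖x - y‖ₑ ^ 2 ≤ 2 * ‖x - z‖ₑ ^ 2 + 2 * ‖z - y‖ₑ ^ 2 := by
  have h : (x - y) ^ 2 ≤ 2 * (x - z) ^ 2 + 2 * (z - y) ^ 2 := by
    nlinarith [sq_nonneg ((x - z) - (z - y))]
  have h' := ENNReal.ofReal_le_ofReal h
  rw [ENNReal.ofReal_add (by positivity) (by positivity), ENNReal.ofReal_mul (by norm_num),
    ENNReal.ofReal_mul (by norm_num)] at h'
  have e : ∀ s : ℝ, ENNReal.ofReal (s ^ 2) = ‖s‖ₑ ^ 2 := fun s => by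
    rw [← sq_abs, ENNReal.ofReal_pow (abs_nonneg s), ← Real.norm_eq_abs, ofReal_norm]
  simpa [e] using h'

theorem edist_le_card_mul_of_adj {ι : Type*} [Fintype ι] (G : SimpleGraph ι)
    {c : ι → ℝ} {s : ENNReal} (hs : ∀ k j, G.Adj k j → edist (c k) (c j) ≤ s) {k j : ι}
    (h : G.Reachable k j) : edist (c k) (c j) ≤ Fintype.card ι * s := by
  classical
  have hw : ∀ {k j : ι} (p : G.Walk k j), edist (c k) (c j) ≤ p.length * s := by
    intro k j p
    induction p with
    | nil => simp
    | cons hadj p ih =>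
      refine (edist_triangle _ _ _).trans ((add_le_add (hs _ _ hadj) ih).trans ?_)
      simp only [SimpleGraph.Walk.length_cons, Nat.cast_add, Nat.cast_one]
      rw [add_mul, one_mul, add_comm]
  obtain ⟨p, hp⟩ := h.exists_isPath
  refine (hw p).trans ?_
  gcongr
  exact_mod_cast hp.length_lt.le

/-- Global weighted Poincaré inequality under the cone condition. -/
theorem exists_global_weighted_poincare (N : ℕ) (hN : 0 < N) {κ a : ℝ} (hκ0 : 0 < κ) (hκ : κ ≤ 1)
    (ha : 0 < a) (d : ℝ) :
    ∃ C : ENNReal, C ≠ ⊤ ∧ ∀ Ω : Set (Euc N), IsOpen Ω → IsConnected Ω → Bornology.IsBounded Ω →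
      Metric.diam Ω ≤ d → BallCone κ a Ω →
      ∀ W : Euc N → ℝ, (∀ x r, 0 < r → ball x r ⊆ Ω → r ^ 2 ≤ W x) →
      ∀ v : Euc N → ℝ, Measurable v → ContDiffOn ℝ 1 v Ω → (∃ M, ∀ x ∈ Ω, |v x| ≤ M) →
      ∃ c : ℝ, ∫⁻ x in Ω, ‖v x - c‖ₑ ^ 2 ≤
        C * ∫⁻ x in Ω, ENNReal.ofReal (W x) * ‖fderiv ℝ v x‖ₑ ^ 2 := by
  classical
  obtain ⟨C₀, hC₀, hloc⟩ := exists_local_weighted_poincare N hκ0 hκ (ℓ := a / 16) (by linarith)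
  set ρ := κ * (a / 16) / 2 with hρ
  have hρ0 : 0 < ρ := by positivity
  have hρa : ρ / 4 ≤ 2 * (a / 16) := by rw [hρ]; nlinarith
  obtain ⟨T', -, hT'f, hT'⟩ := (isCompact_closedBall (0 : Euc N) d).finite_cover_balls
    (e := ρ / 4) (by positivity)
  set T := hT'f.toFinset with hT
  set V := volume (ball (0 : Euc N) (κ * (ρ / 4))) with hV
  have hV0 : V ≠ 0 := (measure_ball_pos volume _ (by positivity)).ne'
  set B := volume (ball (0 : Euc N) ρ) with hB
  set n : ENNReal := (Fintype.card T : ENNReal) with hn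
  set C₁ : ENNReal := 4 * C₀ / V with hC₁
  have hC₁t : C₁ ≠ ⊤ := ENNReal.div_ne_top (ENNReal.mul_ne_top (by norm_num) hC₀) hV0
  refine ⟨n * (2 * C₀ + 2 * (n ^ 2 * C₁ * B)), ?_, ?_⟩
  · have : B ≠ ⊤ := measure_ball_lt_top.ne
    have : n ≠ ⊤ := ENNReal.natCast_ne_top _
    finiteness
  intro Ω hΩ hΩc hΩb hdiam hcone W hW v hvm hv hvb
  set D := ∫⁻ x in Ω, ENNReal.ofReal (W x) * ‖fderiv ℝ v x‖ₑ ^ 2 with hD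
  obtain ⟨p₀, hp₀⟩ := hΩc.nonempty
  let ι := {t : T // (Ω ∩ ball (p₀ + (t : Euc N)) (ρ / 4)).Nonempty}
  have hp : ∀ k : ι, ∃ p ∈ Ω, dist p (p₀ + (k.1 : Euc N)) < ρ / 4 := fun k => by
    obtain ⟨p, h1, h2⟩ := k.2
    exact ⟨p, h1, h2⟩
  choose p hpΩ hpd using hp
  have hcov : ∀ x ∈ Ω, ∃ k : ι, dist x (p k) < ρ / 2 := by
    intro x hx
    have h1 : x - p₀ ∈ closedBall (0 : Euc N) d := by
      rw [mem_closedBall_zero_iff, ← dist_eq_norm]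
      exact (dist_le_diam_of_mem hΩb hx hp₀).trans hdiam
    obtain ⟨t, ht, hxt⟩ := mem_iUnion₂.1 (hT' h1)
    have hxt' : dist x (p₀ + t) < ρ / 4 := by
      rw [mem_ball, dist_eq_norm] at hxt
      rw [dist_eq_norm]
      convert hxt using 2
      abel
    refine ⟨⟨⟨t, hT'f.mem_toFinset.2 ht⟩, x, hx, hxt'⟩, ?_⟩
    have := hpd ⟨⟨t, hT'f.mem_toFinset.2 ht⟩, x, hx, hxt'⟩
    have h2 := dist_triangle_right x (p ⟨⟨t, hT'f.mem_toFinset.2 ht⟩, x, hx, hxt'⟩) (p₀ + t)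
    linarith
  have hcL : ∀ k : ι, ∃ c : ℝ, ∫⁻ x in Ω ∩ ball (p k) ρ, ‖v x - c‖ₑ ^ 2 ≤ C₀ * D := by
    intro k
    obtain ⟨ω, hω, hdir⟩ := hcone.exists_direction hN hκ ha (hpΩ k)
    exact hloc Ω hΩ hΩb W hW (p k) (hpΩ k) ω hω hdir v hvm hv hvb
  choose c hc using hcL
  let G : SimpleGraph ι :=
    { Adj := fun k j => k ≠ j ∧ ∃ w ∈ Ω, dist w (p k) < ρ / 2 ∧ dist w (p j) < ρ / 2
      symm := ⟨fun k j ⟨h1, w, hw, h2, h3⟩ => ⟨h1.symm, w, hw, h3, h2⟩⟩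
      loopless := ⟨fun k h => h.1 rfl⟩ }
  set s : ENNReal := (C₁ * D) ^ (1 / 2 : ℝ) with hs
  have hs2 : s ^ 2 = C₁ * D := by
    rw [hs, ← ENNReal.rpow_natCast, ← ENNReal.rpow_mul]; norm_num
  have hm : ∀ b : ℝ, Measurable fun x => ‖v x - b‖ₑ ^ 2 := fun b =>
    (hvm.sub_const b).enorm.pow_const 2
  have hadj : ∀ k j, G.Adj k j → edist (c k) (c j) ≤ s := by
    rintro k j ⟨-, w, hw, hwk, hwj⟩
    obtain ⟨ω, hω, hdir⟩ := hcone.exists_direction hN hκ ha hw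
    have hbΩ := hdir w hw (by simpa using ha) (ρ / 4) ⟨by positivity, hρa⟩
    set b := ball (w + (ρ / 4) • ω) (κ * (ρ / 4)) with hb
    have hbw : ∀ i : ι, dist w (p i) < ρ / 2 → b ⊆ Ω ∩ ball (p i) ρ := by
      intro i hi x hx
      refine ⟨hbΩ hx, ?_⟩
      rw [hb, mem_ball] at hx
      rw [mem_ball]
      have h1 : dist (w + (ρ / 4) • ω) w = ρ / 4 := by
        rw [dist_eq_norm, add_sub_cancel_left, norm_smul, hω, mul_one,
          Real.norm_of_nonneg (by positivity)]
      have h2 : κ * (ρ / 4) ≤ ρ / 4 := by nlinarith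
      linarith [dist_triangle x (w + (ρ / 4) • ω) w, dist_triangle x w (p i)]
    have hbV : volume b = V := Measure.addHaar_ball_center _ _ _
    have h4 : ‖c k - c j‖ₑ ^ 2 * V ≤ 4 * C₀ * D := by
      calc ‖c k - c j‖ₑ ^ 2 * V = ∫⁻ x in b, ‖c k - c j‖ₑ ^ 2 := by rw [setLIntegral_const, hbV]
        _ ≤ ∫⁻ x in b, (2 * ‖v x - c k‖ₑ ^ 2 + 2 * ‖v x - c j‖ₑ ^ 2) := by
          refine lintegral_mono fun x => ?_
          have := enorm_sub_sq_le_two_mul (c k) (c j) (v x)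
          rwa [← enorm_neg (c k - v x), neg_sub] at this
        _ = 2 * (∫⁻ x in b, ‖v x - c k‖ₑ ^ 2) + 2 * ∫⁻ x in b, ‖v x - c j‖ₑ ^ 2 := by
          rw [lintegral_add_left ((hm _).const_mul _), lintegral_const_mul _ (hm _),
            lintegral_const_mul _ (hm _)]
        _ ≤ 2 * (C₀ * D) + 2 * (C₀ * D) := by
          gcongr
          · exact (lintegral_mono_set (hbw k hwk)).trans (hc k)
          · exact (lintegral_mono_set (hbw j hwj)).trans (hc j)
        _ = _ := by ring
    have h5 : ‖c k - c j‖ₑ ^ 2 ≤ C₁ * D := by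
      have : V ≠ ⊤ := measure_ball_lt_top.ne
      rw [hC₁, ENNReal.div_eq_inv_mul, mul_assoc, mul_comm, ← ENNReal.div_eq_inv_mul.trans (mul_comm _ _), ENNReal.le_div_iff_mul_le (Or.inl hV0) (Or.inl this)]
      exact h4
    rw [edist_eq_enorm_sub]
    rw [← hs2] at h5
    exact (ENNReal.pow_le_pow_left_iff two_ne_zero).1 h5
  obtain ⟨k₀, -⟩ := hcov p₀ hp₀
  have hreach : ∀ k, G.Reachable k₀ k := by
    by_contra! hne
    obtain ⟨k₁, hk₁⟩ := hne
    have ho : ∀ P : ι → Prop, IsOpen (⋃ k, ⋃ (_ : P k), ball (p k) (ρ / 2)) := fun P =>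
      isOpen_iUnion fun k => isOpen_iUnion fun _ => isOpen_ball
    obtain ⟨w, hw, h1, h2⟩ := hΩc.isPreconnected _ _ (ho fun k => G.Reachable k₀ k)
      (ho fun k => ¬ G.Reachable k₀ k) (by
        intro x hx
        obtain ⟨k, hk⟩ := hcov x hx
        by_cases h : G.Reachable k₀ k
        · exact Or.inl (mem_iUnion₂.2 ⟨k, h, hk⟩)
        · exact Or.inr (mem_iUnion₂.2 ⟨k, h, hk⟩))
      ⟨p k₀, hpΩ k₀, mem_iUnion₂.2 ⟨k₀, SimpleGraph.Reachable.refl _, mem_ball_self (by positivity)⟩⟩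
      ⟨p k₁, hpΩ k₁, mem_iUnion₂.2 ⟨k₁, hk₁, mem_ball_self (by positivity)⟩⟩
    obtain ⟨k, hk, hwk⟩ := mem_iUnion₂.1 h1
    obtain ⟨j, hj, hwj⟩ := mem_iUnion₂.1 h2
    refine hj (hk.trans (SimpleGraph.Adj.reachable (G := G) ⟨?_, w, hw, hwk, hwj⟩))
    rintro rfl
    exact hj hk
  have hcard : (Fintype.card ι : ENNReal) ≤ n := by
    rw [hn]
    exact_mod_cast Fintype.card_subtype_le _
  have hck : ∀ k, ‖c k - c k₀‖ₑ ^ 2 ≤ n ^ 2 * C₁ * D := by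
    intro k
    have h1 := edist_le_card_mul_of_adj G hadj (hreach k).symm
    rw [edist_eq_enorm_sub] at h1
    calc _ ≤ (n * s) ^ 2 := by gcongr; exact h1.trans (by gcongr)
      _ = n ^ 2 * s ^ 2 := by ring
      _ = _ := by rw [hs2]; ring
  refine ⟨c k₀, ?_⟩
  calc ∫⁻ x in Ω, ‖v x - c k₀‖ₑ ^ 2
      ≤ ∫⁻ x in ⋃ k, Ω ∩ ball (p k) ρ, ‖v x - c k₀‖ₑ ^ 2 := by
        refine lintegral_mono_set fun x hx => ?_
        obtain ⟨k, hk⟩ := hcov x hx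
        exact mem_iUnion.2 ⟨k, hx, mem_ball.2 (by linarith)⟩
    _ ≤ ∑ k, ∫⁻ x in Ω ∩ ball (p k) ρ, ‖v x - c k₀‖ₑ ^ 2 := by
        exact (lintegral_iUnion_le _ _).trans (tsum_fintype _).le
    _ ≤ ∑ k : ι, (2 * C₀ + 2 * (n ^ 2 * C₁ * B)) * D := by
        refine Finset.sum_le_sum fun k _ => ?_
        calc _ ≤ ∫⁻ x in Ω ∩ ball (p k) ρ, (2 * ‖v x - c k‖ₑ ^ 2 + 2 * ‖c k - c k₀‖ₑ ^ 2) :=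
              lintegral_mono fun x => enorm_sub_sq_le_two_mul _ _ _
          _ = 2 * (∫⁻ x in Ω ∩ ball (p k) ρ, ‖v x - c k‖ₑ ^ 2)
              + 2 * ‖c k - c k₀‖ₑ ^ 2 * volume (Ω ∩ ball (p k) ρ) := by
            rw [lintegral_add_left ((hm _).const_mul _), lintegral_const_mul _ (hm _),
              setLIntegral_const]
          _ ≤ 2 * (C₀ * D) + 2 * (n ^ 2 * C₁ * D) * B := by
            gcongr
            · exact hc k
            · exact hck k
            · exact (measure_mono inter_subset_right).trans
                (Measure.addHaar_ball_center _ _ _).le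
          _ = _ := by ring
    _ = Fintype.card ι * ((2 * C₀ + 2 * (n ^ 2 * C₁ * B)) * D) := by simp
    _ ≤ n * ((2 * C₀ + 2 * (n ^ 2 * C₁ * B)) * D) := by gcongr
    _ = _ := by ring

theorem contDiff_mul_of_tsupport_subset {N : ℕ} {n : WithTop ℕ∞} {Ω : Set (Euc N)} (hΩ : IsOpen Ω)
    {f q : Euc N → ℝ} (hf : ContDiff ℝ n f) (hs : tsupport f ⊆ Ω) (hq : ContDiffOn ℝ n q Ω) :
    ContDiff ℝ n fun x => f x * q x := by
  rw [contDiff_iff_contDiffAt]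
  intro x
  by_cases hx : x ∈ tsupport f
  · exact hf.contDiffAt.mul (hq.contDiffAt (hΩ.mem_nhds (hs hx)))
  · refine (contDiffAt_const (c := (0 : ℝ))).congr_of_eventuallyEq ?_
    filter_upwards [notMem_tsupport_iff_eventuallyEq.1 hx] with y hy
    simp [hy]

theorem continuous_mul_of_tsupport_subset {N : ℕ} {Ω : Set (Euc N)} (hΩ : IsOpen Ω)
    {f q : Euc N → ℝ} (hf : Continuous f) (hs : tsupport f ⊆ Ω) (hq : ContinuousOn q Ω) :
    Continuous fun x => f x * q x := by
  have h := contDiff_mul_of_tsupport_subset (n := 0) hΩ (contDiff_zero.2 hf) hs (contDiffOn_zero.2 hq)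
  exact contDiff_zero.1 h

theorem integrable_mul_of_tsupport_subset {N : ℕ} {Ω : Set (Euc N)} (hΩ : IsOpen Ω)
    {f q : Euc N → ℝ} (hf : Continuous f) (hc : HasCompactSupport f) (hs : tsupport f ⊆ Ω)
    (hq : ContinuousOn q Ω) : Integrable fun x => f x * q x :=
  (continuous_mul_of_tsupport_subset hΩ hf hs hq).integrable_of_hasCompactSupport hc.mul_right

/-- Integration by parts against a compactly supported function. -/
theorem integral_mul_fderiv_eq_neg_of_tsupport_subset {N : ℕ} {Ω : Set (Euc N)} (hΩ : IsOpen Ω)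
    {f q : Euc N → ℝ} (hf : ContDiff ℝ 1 f) (hc : HasCompactSupport f) (hs : tsupport f ⊆ Ω)
    (hq : ContDiffOn ℝ 1 q Ω) (e : Euc N) :
    ∫ x, f x * fderiv ℝ q x e = -∫ x, fderiv ℝ f x e * q x := by
  have hq' : ContinuousOn (fun x => fderiv ℝ q x e) Ω :=
    (hq.continuousOn_fderiv_of_isOpen hΩ le_rfl).clm_apply continuousOn_const
  have hf' : Continuous fun x => fderiv ℝ f x e :=
    (hf.continuous_fderiv (by norm_num)).clm_apply continuous_const
  refine integral_mul_fderiv_eq_neg_fderiv_mul_of_integrable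
    (integrable_mul_of_tsupport_subset hΩ hf' (hc.fderiv_apply (𝕜 := ℝ) e)
      ((tsupport_fderiv_apply_subset ℝ e).trans hs) hq.continuousOn)
    (integrable_mul_of_tsupport_subset hΩ hf.continuous hc hs hq')
    (integrable_mul_of_tsupport_subset hΩ hf.continuous hc hs hq.continuousOn)
    (fun x _ => (hf.differentiable (by norm_num)) x)
    (fun x hx => (hq.contDiffAt (hΩ.mem_nhds (hs hx))).differentiableAt (by norm_num))

theorem integral_fderiv_eq_zero {N : ℕ} {f : Euc N → ℝ} (hf : ContDiff ℝ 1 f)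
    (hc : HasCompactSupport f) (e : Euc N) : ∫ x, fderiv ℝ f x e = 0 := by
  have := integral_mul_fderiv_eq_neg_of_tsupport_subset isOpen_univ hf hc (subset_univ _)
    (contDiffOn_const (c := (1 : ℝ))) e
  simpa using this

open Topology Filter in
theorem hasDerivAt_integral_mul_translate {N : ℕ} {Ω : Set (Euc N)} (hΩ : IsOpen Ω)
    {f q : Euc N → ℝ} (hf : Continuous f) (hc : HasCompactSupport f) (hs : tsupport f ⊆ Ω)
    (hq : ContDiffOn ℝ 1 q Ω) {e : Euc N} (he : ‖e‖ = 1) :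
    HasDerivAt (fun t : ℝ => ∫ x, f x * q (x + t • e)) (∫ x, f x * fderiv ℝ q x e) 0 := by
  obtain ⟨δ, hδ, hδΩ⟩ := IsCompact.exists_cthickening_subset_open hc.isCompact hΩ hs
  have hq' : ContinuousOn (fun x => fderiv ℝ q x e) Ω :=
    (hq.continuousOn_fderiv_of_isOpen hΩ le_rfl).clm_apply continuousOn_const
  obtain ⟨M, hM⟩ := (hc.isCompact.cthickening (r := δ)).exists_bound_of_continuousOn
    (hq'.mono hδΩ)
  have hmem : ∀ x ∈ tsupport f, ∀ t ∈ ball (0 : ℝ) δ, x + t • e ∈ cthickening δ (tsupport f) := by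
    intro x hx t ht
    refine mem_cthickening_of_dist_le _ x _ _ hx ?_
    rw [dist_eq_norm, add_sub_cancel_left, norm_smul, he, mul_one]
    exact (mem_ball_zero_iff.1 ht).le
  have hcont : ∀ t ∈ ball (0 : ℝ) δ, Continuous fun x => f x * q (x + t • e) := by
    intro t ht
    have ho : IsOpen ((fun x : Euc N => x + t • e) ⁻¹' Ω) :=
      hΩ.preimage (by fun_prop : Continuous fun x : Euc N => x + t • e)
    refine continuous_mul_of_tsupport_subset ho hf (fun x hx => hδΩ (hmem x hx t ht)) ?_
    exact hq.continuousOn.comp (by fun_prop) fun x hx => hx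
  have h := hasDerivAt_integral_of_dominated_loc_of_deriv_le (μ := (volume : Measure (Euc N)))
    (F := fun (t : ℝ) x => f x * q (x + t • e)) (x₀ := (0 : ℝ))
    (F' := fun t x => f x * fderiv ℝ q (x + t • e) e) (bound := fun x => ‖f x‖ * M)
    (s := ball 0 δ) (ball_mem_nhds _ hδ)
    (by
      filter_upwards [ball_mem_nhds (0 : ℝ) hδ] with t ht
      exact (hcont t ht).aestronglyMeasurable)
    (by simpa using integrable_mul_of_tsupport_subset hΩ hf hc hs hq.continuousOn)
    (by simpa using (integrable_mul_of_tsupport_subset hΩ hf hc hs hq').aestronglyMeasurable)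
    (by
      refine Eventually.of_forall fun x t ht => ?_
      rw [norm_mul]
      by_cases hx : x ∈ tsupport f
      · gcongr
        exact hM _ (hmem x hx t ht)
      · simp [image_eq_zero_of_notMem_tsupport hx])
    ((hf.integrable_of_hasCompactSupport hc).norm.mul_const M)
    (by
      refine Eventually.of_forall fun x t ht => ?_
      by_cases hx : x ∈ tsupport f
      · refine HasDerivAt.const_mul _ ?_
        have hl : HasDerivAt (fun t : ℝ => x + t • e) e t := by
          simpa using ((hasDerivAt_id t).smul_const e).const_add x
        exact ((hq.contDiffAt (hΩ.mem_nhds (hδΩ (hmem x hx t ht)))).differentiableAt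
          (by norm_num)).hasFDerivAt.comp_hasDerivAt t hl
      · simp only [image_eq_zero_of_notMem_tsupport hx, zero_mul]
        exact hasDerivAt_const _ _)
  simpa using h.2

theorem hessEntry_symm {N : ℕ} {h : Euc N → ℝ} {x : Euc N} (hh : ContDiffAt ℝ 2 h x)
    (i j : Fin N) : hessEntry h x i j = hessEntry h x j i := by
  have hd : DifferentiableAt ℝ (fderiv ℝ h) x :=
    (hh.fderiv_right (m := 1) (by norm_num)).differentiableAt (by norm_num)
  have e : ∀ k l, hessEntry h x k l = fderiv ℝ (fderiv ℝ h) x (EuclideanSpace.single k 1)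
      (EuclideanSpace.single l 1) := by
    intro k l
    unfold hessEntry
    rw [fderiv_clm_apply hd (differentiableAt_const _)]
    simp
  rw [e, e]
  exact (hh.isSymmSndFDerivAt (by simp)) _ _

open Topology Filter in
/-- Derivatives of a harmonic `C²` function are weakly harmonic. -/
theorem sum_integral_fderiv_mul_hessEntry_eq_zero {N : ℕ} {Ω : Set (Euc N)} (hΩ : IsOpen Ω)
    {h ψ : Euc N → ℝ} (hh : ContDiffOn ℝ 2 h Ω) (hl : ∀ x ∈ Ω, lap h x = 0)
    (hψ : ContDiff ℝ 1 ψ) (hc : HasCompactSupport ψ) (hs : tsupport ψ ⊆ Ω) (j : Fin N) :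
    ∑ i, ∫ x, fderiv ℝ ψ x (EuclideanSpace.single i 1) * hessEntry h x i j = 0 := by
  have hhi : ∀ i, ContDiffOn ℝ 1 (fun y => fderiv ℝ h y (EuclideanSpace.single i 1)) Ω :=
    fun i x hx => (contDiffAt_fderiv_apply (hh.contDiffAt (hΩ.mem_nhds hx)) _).contDiffWithinAt
  set e : Euc N := EuclideanSpace.single j 1 with he
  have he1 : ‖e‖ = 1 := by simp [he]
  have hψ' : ∀ i : Fin N, Continuous fun x => fderiv ℝ ψ x (EuclideanSpace.single i 1) := fun i =>
    (hψ.continuous_fderiv (by norm_num)).clm_apply continuous_const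
  have hder : HasDerivAt (fun t : ℝ => ∑ i, ∫ x, fderiv ℝ ψ x (EuclideanSpace.single i 1) *
      fderiv ℝ h (x + t • e) (EuclideanSpace.single i 1))
      (∑ i, ∫ x, fderiv ℝ ψ x (EuclideanSpace.single i 1) * hessEntry h x j i) 0 :=
    HasDerivAt.fun_sum fun i _ => hasDerivAt_integral_mul_translate hΩ (hψ' i)
      (hc.fderiv_apply (𝕜 := ℝ) _) ((tsupport_fderiv_apply_subset ℝ _).trans hs) (hhi i) he1
  obtain ⟨δ, hδ, hδΩ⟩ := IsCompact.exists_cthickening_subset_open hc.isCompact hΩ hs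
  have hzero : (fun t : ℝ => ∑ i, ∫ x, fderiv ℝ ψ x (EuclideanSpace.single i 1) *
      fderiv ℝ h (x + t • e) (EuclideanSpace.single i 1)) =ᶠ[𝓝 0] fun _ => 0 := by
    filter_upwards [ball_mem_nhds (0 : ℝ) hδ] with t ht
    have ho : IsOpen ((fun x : Euc N => x + t • e) ⁻¹' Ω) :=
      hΩ.preimage (by fun_prop : Continuous fun x : Euc N => x + t • e)
    have hts : tsupport ψ ⊆ (fun x : Euc N => x + t • e) ⁻¹' Ω := by
      intro x hx
      refine hδΩ (mem_cthickening_of_dist_le _ x _ _ hx ?_)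
      rw [dist_eq_norm, add_sub_cancel_left, norm_smul, he1, mul_one]
      exact (mem_ball_zero_iff.1 ht).le
    have hti : ∀ i, ContDiffOn ℝ 1 (fun y => fderiv ℝ h (y + t • e) (EuclideanSpace.single i 1))
        ((fun x : Euc N => x + t • e) ⁻¹' Ω) := fun i =>
      (hhi i).comp (by fun_prop : ContDiff ℝ 1 fun x : Euc N => x + t • e).contDiffOn
        fun x hx => hx
    have hti' : ∀ i x, fderiv ℝ (fun y => fderiv ℝ h (y + t • e) (EuclideanSpace.single i 1)) x
        (EuclideanSpace.single i 1) = hessEntry h (x + t • e) i i := fun i x => by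
      rw [fderiv_comp_add_right (f := fun y => fderiv ℝ h y (EuclideanSpace.single i 1))]
      rfl
    have hint : ∀ i, ∫ x, fderiv ℝ ψ x (EuclideanSpace.single i 1) *
        fderiv ℝ h (x + t • e) (EuclideanSpace.single i 1)
        = -∫ x, ψ x * hessEntry h (x + t • e) i i := fun i => by
      have := integral_mul_fderiv_eq_neg_of_tsupport_subset ho hψ hc hts (hti i)
        (EuclideanSpace.single i 1)
      simp only [hti'] at this
      rw [this, neg_neg]
    have hcon : ∀ i, Integrable fun x => ψ x * hessEntry h (x + t • e) i i := fun i => by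
      refine integrable_mul_of_tsupport_subset ho hψ.continuous hc hts ?_
      have := ((hti i).continuousOn_fderiv_of_isOpen ho le_rfl).clm_apply
        (continuousOn_const (c := (EuclideanSpace.single i 1 : Euc N)))
      simpa only [hti'] using this
    simp only [hint, Finset.sum_neg_distrib]
    rw [← integral_finsetSum _ fun i _ => hcon i, neg_eq_zero]
    refine integral_eq_zero_of_ae (Eventually.of_forall fun x => ?_)
    simp only [← Finset.mul_sum]
    by_cases hx : x ∈ tsupport ψ
    · have := hl _ (hts hx)
      rw [lap] at this
      simp [this]
    · simp [image_eq_zero_of_notMem_tsupport hx]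
  have h0 := (hder.congr_of_eventuallyEq hzero.symm).unique (hasDerivAt_const _ _)
  rw [← h0]
  refine Finset.sum_congr rfl fun i _ => integral_congr_ae (Eventually.of_forall fun x => ?_)
  by_cases hx : x ∈ tsupport ψ
  · simp only [hessEntry_symm (hh.contDiffAt (hΩ.mem_nhds (hs hx))) i j]
  · have : x ∉ tsupport fun x => fderiv ℝ ψ x (EuclideanSpace.single i 1) := fun hx' =>
      hx (tsupport_fderiv_apply_subset ℝ _ hx')
    have h1 := image_eq_zero_of_notMem_tsupport this
    simp [h1]

/-- Green's identity for the square of a derivative of a harmonic function. -/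
theorem integral_lap_mul_sq_eq {N : ℕ} {Ω : Set (Euc N)} (hΩ : IsOpen Ω)
    {h ζ : Euc N → ℝ} (hh : ContDiffOn ℝ 2 h Ω) (hl : ∀ x ∈ Ω, lap h x = 0)
    (hζ : ContDiff ℝ 2 ζ) (hc : HasCompactSupport ζ) (hs : tsupport ζ ⊆ Ω) (j : Fin N) :
    ∫ x, lap ζ x * (fderiv ℝ h x (EuclideanSpace.single j 1)) ^ 2 =
      2 * ∫ x, ζ x * ∑ i, hessEntry h x i j ^ 2 := by
  set v : Euc N → ℝ := fun x => fderiv ℝ h x (EuclideanSpace.single j 1) with hv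
  have hvC : ContDiffOn ℝ 1 v Ω :=
    fun x hx => (contDiffAt_fderiv_apply (hh.contDiffAt (hΩ.mem_nhds hx)) _).contDiffWithinAt
  have hvd : ∀ x ∈ Ω, DifferentiableAt ℝ v x := fun x hx =>
    (hvC.contDiffAt (hΩ.mem_nhds hx)).differentiableAt (by norm_num)
  have hζ1 : ContDiff ℝ 1 ζ := hζ.of_le (by norm_num)
  set ψ : Euc N → ℝ := fun x => ζ x * v x with hψ
  have hψC : ContDiff ℝ 1 ψ := contDiff_mul_of_tsupport_subset hΩ hζ1 hs hvC
  have hψs : tsupport ψ ⊆ Ω := (tsupport_mul_subset_left).trans hs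
  have hdζ : ∀ i : Fin N, ContDiff ℝ 1 fun x => fderiv ℝ ζ x (EuclideanSpace.single i 1) := fun i =>
    contDiff_iff_contDiffAt.2 fun x => contDiffAt_fderiv_apply hζ.contDiffAt _
  have hdζs : ∀ i : Fin N, tsupport (fun x => fderiv ℝ ζ x (EuclideanSpace.single i 1)) ⊆ tsupport ζ :=
    fun i => tsupport_fderiv_apply_subset ℝ _
  have hdζc : ∀ i : Fin N, HasCompactSupport fun x => fderiv ℝ ζ x (EuclideanSpace.single i 1) :=
    fun i => hc.fderiv_apply (𝕜 := ℝ) _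
  have hess : ∀ i x, fderiv ℝ v x (EuclideanSpace.single i 1) = hessEntry h x i j := fun i x => rfl
  have hhc : ∀ i, ContinuousOn (fun x => hessEntry h x i j) Ω := fun i =>
    (hvC.continuousOn_fderiv_of_isOpen hΩ le_rfl).clm_apply continuousOn_const
  have hzero := sum_integral_fderiv_mul_hessEntry_eq_zero hΩ hh hl hψC hc.mul_right hψs j
  have hI1 : ∀ i, Integrable fun x => ζ x * hessEntry h x i j ^ 2 := fun i =>
    integrable_mul_of_tsupport_subset hΩ hζ.continuous hc hs ((hhc i).pow 2)
  have hI2 : ∀ i, Integrable fun x =>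
      fderiv ℝ ζ x (EuclideanSpace.single i 1) * (v x * hessEntry h x i j) := fun i =>
    integrable_mul_of_tsupport_subset hΩ (hdζ i).continuous (hdζc i) ((hdζs i).trans hs)
      (hvC.continuousOn.mul (hhc i))
  have hψd : ∀ i x, fderiv ℝ ψ x (EuclideanSpace.single i 1) * hessEntry h x i j =
      ζ x * hessEntry h x i j ^ 2 +
        fderiv ℝ ζ x (EuclideanSpace.single i 1) * (v x * hessEntry h x i j) := by
    intro i x
    by_cases hx : x ∈ tsupport ζ
    · have : fderiv ℝ ψ x = ζ x • fderiv ℝ v x + v x • fderiv ℝ ζ x :=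
        fderiv_fun_mul (hζ.differentiable (by norm_num) x) (hvd x (hs hx))
      rw [this]
      simp only [add_apply, smul_apply, smul_eq_mul, hess]
      ring
    · have h1 : fderiv ℝ ψ x (EuclideanSpace.single i 1) = 0 :=
        image_eq_zero_of_notMem_tsupport (f := fun x => fderiv ℝ ψ x (EuclideanSpace.single i 1))
          fun h' => hx (tsupport_mul_subset_left (tsupport_fderiv_apply_subset ℝ _ h'))
      have h2 : fderiv ℝ ζ x (EuclideanSpace.single i 1) = 0 :=
        image_eq_zero_of_notMem_tsupport (f := fun x => fderiv ℝ ζ x (EuclideanSpace.single i 1))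
          fun h' => hx (hdζs i h')
      rw [h1, h2, image_eq_zero_of_notMem_tsupport hx]
      ring
  have hsum : ∀ i, ∫ x, fderiv ℝ ψ x (EuclideanSpace.single i 1) * hessEntry h x i j =
      (∫ x, ζ x * hessEntry h x i j ^ 2) +
        ∫ x, fderiv ℝ ζ x (EuclideanSpace.single i 1) * (v x * hessEntry h x i j) := by
    intro i
    simp only [hψd]
    exact integral_add (hI1 i) (hI2 i)
  have hlapi : ∀ i, ∫ x, hessEntry ζ x i i * v x ^ 2 =
      -(2 * ∫ x, fderiv ℝ ζ x (EuclideanSpace.single i 1) * (v x * hessEntry h x i j)) := by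
    intro i
    have h1 := integral_mul_fderiv_eq_neg_of_tsupport_subset hΩ (hdζ i) (hdζc i)
      ((hdζs i).trans hs) (hvC.pow 2) (EuclideanSpace.single i 1)
    have h2 : ∫ x, fderiv ℝ ζ x (EuclideanSpace.single i 1) *
        fderiv ℝ (fun x => v x ^ 2) x (EuclideanSpace.single i 1) =
        2 * ∫ x, fderiv ℝ ζ x (EuclideanSpace.single i 1) * (v x * hessEntry h x i j) := by
      rw [← integral_const_mul]
      refine integral_congr_ae (Filter.Eventually.of_forall fun x => ?_)
      by_cases hx : x ∈ tsupport ζ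
      · have : fderiv ℝ (fun x => v x ^ 2) x = (2 * v x) • fderiv ℝ v x := by
          rw [((hvd x (hs hx)).hasFDerivAt.pow 2).fderiv]
          simp
        simp only [this, smul_apply, smul_eq_mul, hess]
        ring
      · have h2 : fderiv ℝ ζ x (EuclideanSpace.single i 1) = 0 :=
          image_eq_zero_of_notMem_tsupport (f := fun x => fderiv ℝ ζ x (EuclideanSpace.single i 1))
            fun h' => hx (hdζs i h')
        simp [h2]
    rw [h2] at h1
    rw [h1, neg_neg]
    rfl
  have hI3 : ∀ i, Integrable fun x => hessEntry ζ x i i * v x ^ 2 := fun i => by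
    refine integrable_mul_of_tsupport_subset hΩ
      (((hdζ i).continuous_fderiv (by norm_num)).clm_apply continuous_const)
      ((hdζc i).fderiv_apply (𝕜 := ℝ) _)
      (((tsupport_fderiv_apply_subset ℝ _).trans (hdζs i)).trans hs) (hvC.continuousOn.pow 2)
  simp only [hsum, Finset.sum_add_distrib] at hzero
  simp only [lap, Finset.sum_mul, Finset.mul_sum]
  rw [integral_finsetSum _ fun i _ => hI3 i, integral_finsetSum _ fun i _ => hI1 i]
  simp only [hlapi, Finset.sum_neg_distrib, ← Finset.mul_sum]
  linarith

theorem integral_lap_eq_zero {N : ℕ} {ζ : Euc N → ℝ} (hζ : ContDiff ℝ 2 ζ)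
    (hc : HasCompactSupport ζ) : ∫ x, lap ζ x = 0 := by
  have hdζ : ∀ i : Fin N, ContDiff ℝ 1 fun x => fderiv ℝ ζ x (EuclideanSpace.single i 1) := fun i =>
    contDiff_iff_contDiffAt.2 fun x => contDiffAt_fderiv_apply hζ.contDiffAt _
  have hdζc : ∀ i : Fin N, HasCompactSupport fun x => fderiv ℝ ζ x (EuclideanSpace.single i 1) :=
    fun i => hc.fderiv_apply (𝕜 := ℝ) _
  simp only [lap]
  rw [integral_finsetSum]
  · exact Finset.sum_eq_zero fun i _ => integral_fderiv_eq_zero (hdζ i) (hdζc i) _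
  · exact fun i _ => (((hdζ i).continuous_fderiv (by norm_num)).clm_apply
      continuous_const).integrable_of_hasCompactSupport ((hdζc i).fderiv_apply (𝕜 := ℝ) _)

open Topology Filter in
/-- A convex `C²` truncation of `t ↦ (-t)⁺`, vanishing for `t ≥ -ε`. -/
theorem exists_truncation {ε : ℝ} (hε : 0 < ε) :
    ∃ Y : ℝ → ℝ, ContDiff ℝ 2 Y ∧ (∀ t, -ε ≤ t → Y t = 0) ∧ (∀ t, 0 ≤ Y t) ∧
      (∀ t ≤ 0, Y t ≤ -t) ∧ (∀ t, deriv Y t ∈ Icc (-1) 0) ∧ (∀ t ≤ -2 * ε, deriv Y t = -1) ∧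
      (∀ t, 0 ≤ deriv (deriv Y) t) ∧ ∀ t, -ε ≤ t → deriv Y t = 0 := by
  set Z : ℝ → ℝ := fun τ => ∫ s in (0 : ℝ)..τ, smoothTransition s with hZ
  have hst : Continuous smoothTransition := smoothTransition.continuous
  have hZd : ∀ τ, HasDerivAt Z (smoothTransition τ) τ := fun τ =>
    intervalIntegral.integral_hasDerivAt_right (hst.intervalIntegrable _ _)
      (hst.stronglyMeasurableAtFilter _ _) hst.continuousAt
  have hd : ∀ t, HasDerivAt (fun t => ε * Z (-t / ε - 1)) (-smoothTransition (-t / ε - 1)) t := by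
    intro t
    have h1 : HasDerivAt (fun t : ℝ => -t / ε - 1) (-1 / ε) t :=
      (((hasDerivAt_id t).neg).div_const ε).sub_const 1
    have h2 := ((hZd _).comp t h1).const_mul ε
    refine h2.congr_deriv ?_
    field_simp
  have hderiv : deriv (fun t => ε * Z (-t / ε - 1)) = fun t => -smoothTransition (-t / ε - 1) :=
    funext fun t => (hd t).deriv
  have hY2 : ContDiff ℝ 2 fun t => -smoothTransition (-t / ε - 1) := by
    refine (smoothTransition.contDiff.comp (g := smoothTransition) ?_).neg
    fun_prop
  have hZ0 : ∀ τ ≤ 0, Z τ = 0 := by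
    intro τ hτ
    rw [hZ]
    simp only
    rw [intervalIntegral.integral_congr (g := fun _ => (0 : ℝ))]
    · simp
    · intro s hs
      rw [uIcc_of_ge hτ] at hs
      exact smoothTransition.zero_of_nonpos hs.2
  have hle : ∀ t, -ε ≤ t → -t / ε - 1 ≤ 0 := by
    intro t ht
    have : -t / ε ≤ 1 := by rw [div_le_one hε]; linarith
    linarith
  have hmono : Monotone smoothTransition := smoothTransition.monotone
  refine ⟨fun t => ε * Z (-t / ε - 1), ?_, fun t ht => ?_, fun t => ?_, fun t ht => ?_, fun t => ?_,
    fun t ht => ?_, fun t => ?_, fun t ht => ?_⟩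
  · have : (2 : WithTop ℕ∞) = 1 + 1 := by norm_num
    rw [this, contDiff_succ_iff_deriv]
    refine ⟨fun t => (hd t).differentiableAt, by simp, ?_⟩
    rw [hderiv]
    exact hY2.of_le (by norm_num)
  · simp [hZ0 _ (hle t ht)]
  · by_cases h : -t / ε - 1 ≤ 0
    · simp [hZ0 _ h]
    · refine mul_nonneg hε.le ?_
      exact intervalIntegral.integral_nonneg (not_le.1 h).le fun s _ => smoothTransition.nonneg s
  · by_cases h : -t / ε - 1 ≤ 0
    · simp [hZ0 _ h, ht]
    · have h1 : Z (-t / ε - 1) ≤ ∫ s in (0 : ℝ)..(-t / ε - 1), (1 : ℝ) :=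
        intervalIntegral.integral_mono_on (not_le.1 h).le (hst.intervalIntegrable _ _) (by simp)
          fun s _ => smoothTransition.le_one s
      have h2 : Z (-t / ε - 1) ≤ -t / ε - 1 := by simpa using h1
      calc ε * Z (-t / ε - 1) ≤ ε * (-t / ε - 1) := by gcongr
        _ = -t - ε := by field_simp
        _ ≤ -t := by linarith
  · rw [hderiv]
    exact ⟨neg_le_neg (smoothTransition.le_one _), neg_nonpos.2 (smoothTransition.nonneg _)⟩
  · rw [hderiv]
    simp only
    rw [smoothTransition.one_of_one_le]
    have : 2 ≤ -t / ε := by rw [le_div_iff₀ hε]; linarith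
    linarith
  · have : Monotone (deriv fun t => ε * Z (-t / ε - 1)) := by
      rw [hderiv]
      intro s t hst
      refine neg_le_neg (hmono ?_)
      gcongr
    exact this.deriv_nonneg
  · rw [hderiv]
    simp [smoothTransition.zero_of_nonpos (hle t ht)]

theorem sum_sq_apply_single {N : ℕ} (L : Euc N →L[ℝ] ℝ) :
    ∑ i, L (EuclideanSpace.single i 1) ^ 2 = ‖L‖ ^ 2 := by
  obtain ⟨y, rfl⟩ := (InnerProductSpace.toDual ℝ (Euc N)).surjective L
  rw [LinearIsometryEquiv.norm_map, EuclideanSpace.norm_sq_eq]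
  simp [InnerProductSpace.toDual_apply_apply, EuclideanSpace.inner_single_right]

/-- Cutoff data attached to a torsion function: `ζ` approximates `-u`, `P` approximates `1` and
`Q` is the density of an approximate boundary measure. -/
structure IsCutoff {N : ℕ} (Ω : Set (Euc N)) (u : Euc N → ℝ) (ε : ℝ) (ζ P Q : Euc N → ℝ) :
    Prop where
  contDiff : ContDiff ℝ 2 ζ
  hasCompactSupport : HasCompactSupport ζ
  tsupport_subset : tsupport ζ ⊆ Ω
  nonneg : ∀ x, 0 ≤ ζ x
  le_neg : ∀ x ∈ Ω, ζ x ≤ -u x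
  fderiv_eq : ∀ x ∈ Ω, fderiv ℝ ζ x = -P x • fderiv ℝ u x
  contDiff_one : ContDiff ℝ 1 P
  hasCompactSupport_one : HasCompactSupport P
  tsupport_one_subset : tsupport P ⊆ Ω
  mem_Icc : ∀ x, P x ∈ Icc 0 1
  eq_zero : ∀ x ∉ Ω, P x = 0
  eq_one : ∀ x ∈ Ω, u x ≤ -2 * ε → P x = 1
  continuous_density : Continuous Q
  lap_eq : ∀ x, lap ζ x = Q x - N * P x
  density_nonneg : ∀ x, 0 ≤ Q x
  density_eq_zero : ∀ x ∉ Ω, Q x = 0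
  le_of_density_ne_zero : ∀ x ∈ Ω, Q x ≠ 0 → -2 * ε ≤ u x
  mul_norm_fderiv_le : ∀ m' : ℝ, (∀ x ∈ Ω, -2 * ε ≤ u x → m' ≤ ‖fderiv ℝ u x‖) →
    ∀ x, m' * ‖fderiv ℝ P x‖ ≤ Q x

open Topology Filter in
theorem IsTorsion.exists_isCutoff {N : ℕ} {Ω : Set (Euc N)} {u : Euc N → ℝ} (hN : 0 < N)
    (hΩ : IsOpen Ω) (hb : Bornology.IsBounded Ω) (hu : IsTorsion Ω u) {ε : ℝ} (hε : 0 < ε) :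
    ∃ ζ P Q : Euc N → ℝ, IsCutoff Ω u ε ζ P Q := by
  classical
  obtain ⟨Y, hYc, hY0, hYnn, hYle, hY', hY'1, hY'', hY'0⟩ := exists_truncation hε
  have hneg := hu.neg hN hΩ hb
  obtain ⟨huc, hu2, hlap, hu0⟩ := hu
  have hY1c : ContDiff ℝ 1 (deriv Y) := ((contDiff_succ_iff_deriv (n := 1)).1
    (by simpa [one_add_one_eq_two] using hYc)).2.2
  set K := closure Ω ∩ u ⁻¹' Iic (-ε) with hK
  have hKcl : IsClosed K := huc.preimage_isClosed_of_isClosed isClosed_closure isClosed_Iic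
  have hKc : IsCompact K := Metric.isCompact_of_isClosed_isBounded hKcl
    (hb.closure.subset inter_subset_left)
  have hKΩ : K ⊆ Ω := by
    intro x hx
    by_contra h
    have h1 : x ∈ frontier Ω := ⟨hx.1, fun h' => h (interior_subset h')⟩
    have h2 : u x ≤ -ε := hx.2
    rw [hu0 x h1] at h2
    linarith
  set ζ : Euc N → ℝ := Ω.indicator fun x => Y (u x) with hζ
  set P : Euc N → ℝ := Ω.indicator fun x => -deriv Y (u x) with hP
  have hud : ∀ x ∈ Ω, ContDiffAt ℝ 2 u x := fun x hx => hu2.contDiffAt (hΩ.mem_nhds hx)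
  have hudd : ∀ x ∈ Ω, DifferentiableAt ℝ u x := fun x hx =>
    (hud x hx).differentiableAt (by norm_num)
  have hζΩ : ∀ x ∈ Ω, ζ =ᶠ[𝓝 x] fun x => Y (u x) := fun x hx => by
    filter_upwards [hΩ.mem_nhds hx] with y hy using indicator_of_mem hy _
  have hPΩ : ∀ x ∈ Ω, P =ᶠ[𝓝 x] fun x => -deriv Y (u x) := fun x hx => by
    filter_upwards [hΩ.mem_nhds hx] with y hy using indicator_of_mem hy _
  have hout : ∀ x ∉ K, x ∈ Ω → -ε ≤ u x := fun x hx hxΩ => by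
    by_contra h
    exact hx ⟨subset_closure hxΩ, (not_le.1 h).le⟩
  have hζK : ∀ x ∉ K, ζ =ᶠ[𝓝 x] fun _ => 0 := fun x hx => by
    filter_upwards [hKcl.isOpen_compl.mem_nhds hx] with y hy
    by_cases hyΩ : y ∈ Ω
    · rw [hζ, indicator_of_mem hyΩ, hY0 _ (hout y hy hyΩ)]
    · exact indicator_of_notMem hyΩ _
  have hPK : ∀ x ∉ K, P =ᶠ[𝓝 x] fun _ => 0 := fun x hx => by
    filter_upwards [hKcl.isOpen_compl.mem_nhds hx] with y hy
    by_cases hyΩ : y ∈ Ω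
    · rw [hP, indicator_of_mem hyΩ, hY'0 _ (hout y hy hyΩ), neg_zero]
    · exact indicator_of_notMem hyΩ _
  have hζc : ContDiff ℝ 2 ζ := contDiff_iff_contDiffAt.2 fun x => by
    by_cases hx : x ∈ K
    · exact (hYc.contDiffAt.comp x (hud x (hKΩ hx))).congr_of_eventuallyEq (hζΩ x (hKΩ hx))
    · exact contDiffAt_const.congr_of_eventuallyEq (hζK x hx)
  have hPc : ContDiff ℝ 1 P := contDiff_iff_contDiffAt.2 fun x => by
    by_cases hx : x ∈ K
    · exact ((hY1c.contDiffAt.comp x ((hud x (hKΩ hx)).of_le (by norm_num))).neg).congr_of_eventuallyEq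
        (hPΩ x (hKΩ hx))
    · exact contDiffAt_const.congr_of_eventuallyEq (hPK x hx)
  have hζsupp : tsupport ζ ⊆ K := closure_minimal (fun x hx => by
    by_contra h
    exact hx (hζK x h).self_of_nhds) hKcl
  have hPsupp : tsupport P ⊆ K := closure_minimal (fun x hx => by
    by_contra h
    exact hx (hPK x h).self_of_nhds) hKcl
  have hYd : ∀ t, HasDerivAt Y (deriv Y t) t := fun t =>
    (hYc.differentiable (by norm_num) t).hasDerivAt
  have hY'd : ∀ t, HasDerivAt (deriv Y) (deriv (deriv Y) t) t := fun t =>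
    (hY1c.differentiable (by norm_num) t).hasDerivAt
  have hfζ : ∀ x ∈ Ω, fderiv ℝ ζ x = deriv Y (u x) • fderiv ℝ u x := fun x hx => by
    rw [(hζΩ x hx).fderiv_eq]
    exact ((hYd _).comp_hasFDerivAt x (hudd x hx).hasFDerivAt).fderiv
  have hfP : ∀ x ∈ Ω, fderiv ℝ P x = -(deriv (deriv Y) (u x) • fderiv ℝ u x) := fun x hx => by
    rw [(hPΩ x hx).fderiv_eq]
    exact ((hY'd _).comp_hasFDerivAt x (hudd x hx).hasFDerivAt).neg.fderiv
  have hhess : ∀ x ∈ Ω, ∀ i, hessEntry ζ x i i = deriv Y (u x) * hessEntry u x i i +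
      deriv (deriv Y) (u x) * fderiv ℝ u x (EuclideanSpace.single i 1) ^ 2 := by
    intro x hx i
    have h1 : (fun y => fderiv ℝ ζ y (EuclideanSpace.single i 1)) =ᶠ[𝓝 x]
        fun y => deriv Y (u y) * fderiv ℝ u y (EuclideanSpace.single i 1) := by
      filter_upwards [hΩ.mem_nhds hx] with y hy
      rw [hfζ y hy]
      rfl
    have h2 := ((hY'd _).comp_hasFDerivAt x (hudd x hx).hasFDerivAt).mul
      ((contDiffAt_fderiv_apply (hud x hx) (EuclideanSpace.single i 1)).differentiableAt
        (by norm_num)).hasFDerivAt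
    unfold hessEntry
    rw [h1.fderiv_eq]
    have h3 := congrArg (fun L : Euc N →L[ℝ] ℝ => L (EuclideanSpace.single i 1)) h2.fderiv
    refine h3.trans ?_
    simp
    ring
  have hlapΩ : ∀ x ∈ Ω, lap ζ x + N * P x = deriv (deriv Y) (u x) * ‖fderiv ℝ u x‖ ^ 2 := by
    intro x hx
    have h1 := hlap x hx
    unfold lap at h1 ⊢
    simp only [hhess x hx, Finset.sum_add_distrib, ← Finset.mul_sum, h1, sum_sq_apply_single]
    rw [hP, indicator_of_mem hx]
    ring
  have hlapK : ∀ x ∉ K, lap ζ x + N * P x = 0 := by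
    intro x hx
    have h1 : ∀ i : Fin N, (fun y => fderiv ℝ ζ y (EuclideanSpace.single i 1)) =ᶠ[𝓝 x]
        fun _ => 0 := fun i => by
      filter_upwards [(hζK x hx).eventuallyEq_nhds] with y hy
      rw [hy.fderiv_eq]
      simp
    have h2 : lap ζ x = 0 := Finset.sum_eq_zero fun i _ => by
      unfold hessEntry
      rw [(h1 i).fderiv_eq]
      simp
    rw [h2, (hPK x hx).self_of_nhds]
    simp
  have hY''0 : ∀ t < -2 * ε, deriv (deriv Y) t = 0 := by
    intro t ht
    have : deriv Y =ᶠ[𝓝 t] fun _ => -1 := by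
      filter_upwards [Iio_mem_nhds ht] with s hs using hY'1 s (le_of_lt hs)
    rw [this.deriv_eq]
    simp
  refine ⟨ζ, P, fun x => lap ζ x + N * P x, hζc, hKc.of_isClosed_subset (isClosed_tsupport _) hζsupp,
    hζsupp.trans hKΩ, fun x => indicator_nonneg (fun _ _ => hYnn _) _, fun x hx => ?_, fun x hx => ?_,
    hPc, hKc.of_isClosed_subset (isClosed_tsupport _) hPsupp, hPsupp.trans hKΩ, fun x => ?_,
    fun x hx => indicator_of_notMem hx _, fun x hx hux => ?_, ?_, fun x => by ring, fun x => ?_,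
    fun x hx => hlapK x fun h => hx (hKΩ h), fun x hx hne => ?_, fun m' hm' x => ?_⟩
  · rw [hζ, indicator_of_mem hx]
    exact hYle _ (hneg x hx).le
  · rw [hfζ x hx, hP, indicator_of_mem hx, neg_neg]
  · by_cases hx : x ∈ Ω
    · rw [hP, indicator_of_mem hx]
      exact ⟨by linarith [(hY' (u x)).2], by linarith [(hY' (u x)).1]⟩
    · rw [hP, indicator_of_notMem hx]
      simp
  · rw [hP, indicator_of_mem hx, hY'1 _ hux, neg_neg]
  · have h1 : ∀ i : Fin N, Continuous fun x => hessEntry ζ x i i := fun i =>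
      ((contDiff_iff_contDiffAt.2 fun x => contDiffAt_fderiv_apply hζc.contDiffAt
        (EuclideanSpace.single i 1)).continuous_fderiv (by norm_num)).clm_apply continuous_const
    exact (continuous_finsetSum _ fun i _ => h1 i).add (continuous_const.mul hPc.continuous)
  · by_cases hx : x ∈ K
    · simp only [hlapΩ x (hKΩ hx)]
      exact mul_nonneg (hY'' _) (sq_nonneg _)
    · exact (hlapK x hx).ge
  · by_contra h
    refine hne ?_
    simp only [hlapΩ x hx, hY''0 _ (not_le.1 h), zero_mul]
  · by_cases hx : x ∈ K
    · have hxΩ := hKΩ hx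
      simp only [hlapΩ x hxΩ]
      rw [hfP x hxΩ, norm_neg, norm_smul, Real.norm_of_nonneg (hY'' _)]
      by_cases h : -2 * ε ≤ u x
      · have h1 := hm' x hxΩ h
        have h2 : 0 ≤ deriv (deriv Y) (u x) * ‖fderiv ℝ u x‖ := mul_nonneg (hY'' _) (norm_nonneg _)
        nlinarith
      · simp [hY''0 _ (not_le.1 h)]
    · simp only [hlapK x hx]
      rw [(hPK x hx).fderiv_eq]
      simp

theorem sum_sq_hessEntry_eq {N : ℕ} (h : Euc N → ℝ) (x : Euc N) :
    hessNormSq h x = ∑ j, ∑ i, hessEntry h x i j ^ 2 := Finset.sum_comm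

theorem lintegral_ofReal_mul_le_setLIntegral {N : ℕ} {Ω : Set (Euc N)} (hΩ : IsOpen Ω)
    {f w q : Euc N → ℝ} (h0 : ∀ x ∉ Ω, f x = 0) (hfw : ∀ x ∈ Ω, f x ≤ w x)
    (hq : ∀ x, 0 ≤ q x) :
    ∫⁻ x, ENNReal.ofReal (f x * q x) ≤ ∫⁻ x in Ω, ENNReal.ofReal (w x * q x) := by
  rw [← lintegral_indicator hΩ.measurableSet]
  refine lintegral_mono fun x => ?_
  by_cases hx : x ∈ Ω
  · rw [indicator_of_mem hx]
    exact ENNReal.ofReal_le_ofReal (mul_le_mul_of_nonneg_right (hfw x hx) (hq x))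
  · simp [h0 x hx]

theorem hessNormSq_nonneg {N : ℕ} (h : Euc N → ℝ) (x : Euc N) : 0 ≤ hessNormSq h x :=
  Finset.sum_nonneg fun _ _ => Finset.sum_nonneg fun _ _ => sq_nonneg _

namespace IsCutoff

variable {N : ℕ} {Ω : Set (Euc N)} {u ζ P Q : Euc N → ℝ} {ε : ℝ}

theorem integrable_lap (hcut : IsCutoff Ω u ε ζ P Q) (hΩ : IsOpen Ω) {q : Euc N → ℝ}
    (hq : ContinuousOn q Ω) : Integrable fun x => lap ζ x * q x := by
  have hdζ : ∀ i : Fin N, ContDiff ℝ 1 fun x => fderiv ℝ ζ x (EuclideanSpace.single i 1) := fun i =>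
    contDiff_iff_contDiffAt.2 fun x => contDiffAt_fderiv_apply hcut.contDiff.contDiffAt _
  simp only [lap, Finset.sum_mul]
  refine integrable_finsetSum _ fun i _ => integrable_mul_of_tsupport_subset hΩ
      (((hdζ i).continuous_fderiv (by norm_num)).clm_apply continuous_const)
      ((hcut.hasCompactSupport.fderiv_apply (𝕜 := ℝ) _).fderiv_apply (𝕜 := ℝ) _) ?_ hq
  exact ((tsupport_fderiv_apply_subset ℝ _).trans (tsupport_fderiv_apply_subset ℝ _)).trans
    hcut.tsupport_subset

/-- The energy bound for `|∇h|²` against the approximate boundary measure. -/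
theorem lintegral_density_mul_le (hcut : IsCutoff Ω u ε ζ P Q) (hΩ : IsOpen Ω)
    {h : Euc N → ℝ} (hh : ContDiffOn ℝ 2 h Ω) (hl : ∀ x ∈ Ω, lap h x = 0) :
    ∫⁻ x, ENNReal.ofReal (Q x * ‖fderiv ℝ h x‖ ^ 2) ≤
      N * (∫⁻ x in Ω, ENNReal.ofReal (‖fderiv ℝ h x‖ ^ 2)) +
        2 * ∫⁻ x in Ω, ENNReal.ofReal (-u x * hessNormSq h x) := by
  have hζ0 : ∀ x ∉ Ω, ζ x = 0 := fun x hx =>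
    image_eq_zero_of_notMem_tsupport fun h' => hx (hcut.tsupport_subset h')
  have hfc : ContinuousOn (fun x => ‖fderiv ℝ h x‖ ^ 2) Ω :=
    ((hh.continuousOn_fderiv_of_isOpen hΩ (by norm_num)).norm).pow 2
  have hvC : ∀ j : Fin N, ContDiffOn ℝ 1 (fun x => fderiv ℝ h x (EuclideanSpace.single j 1)) Ω :=
    fun j x hx => (contDiffAt_fderiv_apply (hh.contDiffAt (hΩ.mem_nhds hx)) _).contDiffWithinAt
  have hhc : ∀ i j, ContinuousOn (fun x => hessEntry h x i j) Ω := fun i j =>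
    ((hvC j).continuousOn_fderiv_of_isOpen hΩ le_rfl).clm_apply continuousOn_const
  have hI1 : Integrable fun x => ζ x * hessNormSq h x := by
    refine integrable_mul_of_tsupport_subset hΩ hcut.contDiff.continuous hcut.hasCompactSupport
      hcut.tsupport_subset ?_
    unfold hessNormSq
    exact continuousOn_finsetSum _ fun i _ => continuousOn_finsetSum _ fun j _ => (hhc i j).pow 2
  have hI1' : ∀ j, Integrable fun x => ζ x * ∑ i, hessEntry h x i j ^ 2 := fun j => by
    refine integrable_mul_of_tsupport_subset hΩ hcut.contDiff.continuous hcut.hasCompactSupport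
      hcut.tsupport_subset ?_
    exact continuousOn_finsetSum _ fun i _ => (hhc i j).pow 2
  have hI2 : Integrable fun x => P x * ‖fderiv ℝ h x‖ ^ 2 :=
    integrable_mul_of_tsupport_subset hΩ hcut.contDiff_one.continuous hcut.hasCompactSupport_one
      hcut.tsupport_one_subset hfc
  have hI3 : Integrable fun x => lap ζ x * ‖fderiv ℝ h x‖ ^ 2 := hcut.integrable_lap hΩ hfc
  have hgreen : ∫ x, lap ζ x * ‖fderiv ℝ h x‖ ^ 2 = 2 * ∫ x, ζ x * hessNormSq h x := by
    have hI4 : ∀ j : Fin N, Integrable fun x =>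
        lap ζ x * fderiv ℝ h x (EuclideanSpace.single j 1) ^ 2 := fun j =>
      hcut.integrable_lap hΩ ((hvC j).continuousOn.pow 2)
    calc ∫ x, lap ζ x * ‖fderiv ℝ h x‖ ^ 2
        = ∫ x, ∑ j, lap ζ x * fderiv ℝ h x (EuclideanSpace.single j 1) ^ 2 := by
          simp only [← sum_sq_apply_single, Finset.mul_sum]
      _ = ∑ j, 2 * ∫ x, ζ x * ∑ i, hessEntry h x i j ^ 2 := by
          rw [integral_finsetSum _ fun j _ => hI4 j]
          exact Finset.sum_congr rfl fun j _ => integral_lap_mul_sq_eq hΩ hh hl hcut.contDiff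
            hcut.hasCompactSupport hcut.tsupport_subset j
      _ = 2 * ∫ x, ζ x * hessNormSq h x := by
          rw [← Finset.mul_sum, ← integral_finsetSum _ fun j _ => hI1' j]
          simp only [sum_sq_hessEntry_eq, Finset.mul_sum]
  have hQ : ∀ x, Q x * ‖fderiv ℝ h x‖ ^ 2 =
      lap ζ x * ‖fderiv ℝ h x‖ ^ 2 + N * (P x * ‖fderiv ℝ h x‖ ^ 2) := fun x => by
    rw [hcut.lap_eq]; ring
  have hQI : Integrable fun x => Q x * ‖fderiv ℝ h x‖ ^ 2 := by
    simp only [hQ]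
    exact hI3.add (hI2.const_mul _)
  have hQint : ∫ x, Q x * ‖fderiv ℝ h x‖ ^ 2 =
      N * (∫ x, P x * ‖fderiv ℝ h x‖ ^ 2) + 2 * ∫ x, ζ x * hessNormSq h x := by
    simp only [hQ]
    rw [integral_add hI3 (hI2.const_mul _), hgreen, integral_const_mul]
    ring
  have hP0 : ∀ x, 0 ≤ P x * ‖fderiv ℝ h x‖ ^ 2 := fun x =>
    mul_nonneg (hcut.mem_Icc x).1 (sq_nonneg _)
  have hζn : ∀ x, 0 ≤ ζ x * hessNormSq h x := fun x =>
    mul_nonneg (hcut.nonneg x) (hessNormSq_nonneg _ _)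
  rw [← ofReal_integral_eq_lintegral_ofReal hQI (Filter.Eventually.of_forall fun x =>
    mul_nonneg (hcut.density_nonneg x) (sq_nonneg _)), hQint, ENNReal.ofReal_add
    (mul_nonneg (by positivity) (integral_nonneg hP0))
    (mul_nonneg (by positivity) (integral_nonneg hζn)),
    ENNReal.ofReal_mul (by positivity), ENNReal.ofReal_mul (by positivity),
    ofReal_integral_eq_lintegral_ofReal hI2 (Filter.Eventually.of_forall hP0),
    ofReal_integral_eq_lintegral_ofReal hI1 (Filter.Eventually.of_forall hζn)]
  rw [ENNReal.ofReal_natCast, show ENNReal.ofReal 2 = 2 from ENNReal.ofReal_ofNat 2]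
  have hA : ∫⁻ x, ENNReal.ofReal (P x * ‖fderiv ℝ h x‖ ^ 2) ≤
      ∫⁻ x in Ω, ENNReal.ofReal (‖fderiv ℝ h x‖ ^ 2) := by
    simpa using lintegral_ofReal_mul_le_setLIntegral hΩ hcut.eq_zero (w := fun _ => 1)
      (fun x _ => (hcut.mem_Icc x).2) (q := fun x => ‖fderiv ℝ h x‖ ^ 2) fun x => sq_nonneg _
  have hB : ∫⁻ x, ENNReal.ofReal (ζ x * hessNormSq h x) ≤
      ∫⁻ x in Ω, ENNReal.ofReal (-u x * hessNormSq h x) :=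
    lintegral_ofReal_mul_le_setLIntegral hΩ hζ0 hcut.le_neg (hessNormSq_nonneg h)
  exact add_le_add (mul_le_mul' le_rfl hA) (mul_le_mul' le_rfl hB)

theorem lintegral_density_le (hcut : IsCutoff Ω u ε ζ P Q) (hΩ : IsOpen Ω) :
    ∫⁻ x, ENNReal.ofReal (Q x) ≤ N * volume Ω := by
  have hPI : Integrable P :=
    hcut.contDiff_one.continuous.integrable_of_hasCompactSupport hcut.hasCompactSupport_one
  have hLI : Integrable fun x => lap ζ x := by
    simpa using hcut.integrable_lap hΩ (continuousOn_const (c := (1 : ℝ)))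
  have hQ : ∀ x, Q x = lap ζ x + N * P x := fun x => by rw [hcut.lap_eq]; ring
  have hQI : Integrable Q := by
    rw [funext hQ]
    exact hLI.add (hPI.const_mul _)
  have hQint : ∫ x, Q x = N * ∫ x, P x := by
    simp only [hQ]
    rw [integral_add hLI (hPI.const_mul _), integral_const_mul,
      integral_lap_eq_zero hcut.contDiff hcut.hasCompactSupport, zero_add]
  rw [← ofReal_integral_eq_lintegral_ofReal hQI (Filter.Eventually.of_forall hcut.density_nonneg),
    hQint, ENNReal.ofReal_mul (by positivity), ofReal_integral_eq_lintegral_ofReal hPI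
      (Filter.Eventually.of_forall fun x => (hcut.mem_Icc x).1)]
  have hA : ∫⁻ x, ENNReal.ofReal (P x) ≤ volume Ω := by
    simpa using lintegral_ofReal_mul_le_setLIntegral hΩ hcut.eq_zero (w := fun _ => 1)
      (fun x _ => (hcut.mem_Icc x).2) (q := fun _ => 1) fun x => zero_le_one
  rw [ENNReal.ofReal_natCast]
  exact mul_le_mul' le_rfl hA

end IsCutoff

open Topology Filter in
theorem IsTorsion.setIntegral_fderiv_eq_zero {N : ℕ} {Ω : Set (Euc N)} {u : Euc N → ℝ} (hN : 0 < N)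
    (hΩ : IsOpen Ω) (hb : Bornology.IsBounded Ω) (hu : IsTorsion Ω u) {M : ℝ}
    (hM : ∀ x ∈ Ω, ‖fderiv ℝ u x‖ ≤ M) {e : Euc N} (he : ‖e‖ = 1) :
    ∫ x in Ω, fderiv ℝ u x e = 0 := by
  have hε : ∀ n : ℕ, (0 : ℝ) < 1 / (n + 1) := fun n => by positivity
  choose ζ P Q hcut using fun n => hu.exists_isCutoff hN hΩ hb (hε n)
  have hneg := hu.neg hN hΩ hb
  have hzero : ∀ n, ∫ x in Ω, P n x * fderiv ℝ u x e = 0 := by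
    intro n
    have h1 := integral_fderiv_eq_zero ((hcut n).contDiff.of_le (by norm_num))
      (hcut n).hasCompactSupport e
    rw [← setIntegral_eq_integral_of_forall_compl_eq_zero (s := Ω)] at h1
    · rw [setIntegral_congr_fun (g := fun x => -fderiv ℝ (ζ n) x e) hΩ.measurableSet, integral_neg,
        h1, neg_zero]
      intro x hx
      simp [(hcut n).fderiv_eq x hx]
    · intro x hx
      refine image_eq_zero_of_notMem_tsupport (f := fun x => fderiv ℝ (ζ n) x e) fun h' => ?_
      exact hx ((hcut n).tsupport_subset (tsupport_fderiv_apply_subset ℝ _ h'))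
  have hlim : Tendsto (fun n => ∫ x in Ω, P n x * fderiv ℝ u x e) atTop
      (𝓝 (∫ x in Ω, fderiv ℝ u x e)) := by
    refine tendsto_integral_of_dominated_convergence (fun _ => M) (fun n => ?_) ?_ (fun n => ?_) ?_
    · exact (((hcut n).contDiff_one.continuous.measurable).mul
        (measurable_fderiv_apply_const ℝ u e)).aestronglyMeasurable
    · exact integrableOn_const hb.measure_lt_top.ne
    · filter_upwards [ae_restrict_mem hΩ.measurableSet] with x hx
      have h1 : ‖fderiv ℝ u x e‖ ≤ M := by
        have := (fderiv ℝ u x).le_opNorm e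
        rw [he, mul_one] at this
        exact this.trans (hM x hx)
      rw [norm_mul, Real.norm_of_nonneg ((hcut n).mem_Icc x).1]
      exact (mul_le_of_le_one_left (norm_nonneg _) ((hcut n).mem_Icc x).2).trans h1
    · filter_upwards [ae_restrict_mem hΩ.measurableSet] with x hx
      have h0 : Tendsto (fun n : ℕ => (1 : ℝ) / (n + 1)) atTop (𝓝 0) :=
        tendsto_one_div_add_atTop_nhds_zero_nat
      have h1 : ∀ᶠ n : ℕ in atTop, (1 : ℝ) / (n + 1) < -u x / 2 :=
        h0.eventually_lt_const (by linarith [hneg x hx])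
      refine tendsto_const_nhds.congr' ?_
      filter_upwards [h1] with n hn
      rw [(hcut n).eq_one x hx (by linarith), one_mul]
  simp only [hzero] at hlim
  exact (tendsto_nhds_unique hlim tendsto_const_nhds)

/-- Near the boundary the gradient keeps half of its boundary lower bound. -/
theorem exists_half_le_norm_of_neg_le {N : ℕ} {Ω : Set (Euc N)} {u : Euc N → ℝ}
    {g : Euc N → Euc N} {m : ℝ} (hb : Bornology.IsBounded Ω)
    (hu : ContinuousOn u (closure Ω)) (hneg : ∀ x ∈ Ω, u x < 0) (hg : ContinuousOn g (closure Ω))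
    (hm : 0 < m) (hgm : ∀ x ∈ frontier Ω, m ≤ ‖g x‖) :
    ∃ ε > 0, ∀ x ∈ Ω, -ε ≤ u x → m / 2 ≤ ‖g x‖ := by
  set K := closure Ω ∩ (fun x => ‖g x‖) ⁻¹' Iic (m / 2) with hK
  have hKc : IsCompact K := Metric.isCompact_of_isClosed_isBounded
    (hg.norm.preimage_isClosed_of_isClosed isClosed_closure isClosed_Iic)
    (hb.closure.subset inter_subset_left)
  rcases K.eq_empty_or_nonempty with hKe | hKne
  · refine ⟨1, one_pos, fun x hx _ => le_of_not_gt fun h => ?_⟩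
    have : x ∈ K := ⟨subset_closure hx, h.le⟩
    simp [hKe] at this
  · obtain ⟨y, hyK, hy⟩ := hKc.exists_isMaxOn hKne (hu.mono inter_subset_left)
    have hyΩ : y ∈ Ω := by
      by_contra h
      have h1 := hgm y ⟨hyK.1, fun h' => h (interior_subset h')⟩
      have h2 : ‖g y‖ ≤ m / 2 := hyK.2
      linarith
    have hyn := hneg y hyΩ
    refine ⟨-u y / 2, by linarith, fun x hx hxu => le_of_not_gt fun h => ?_⟩
    have h1 : u x ≤ u y := hy (show x ∈ K from ⟨subset_closure hx, h.le⟩)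
    linarith

/-- The approximate boundary measure of a ball centred on the boundary is bounded below. -/
theorem IsCutoff.mul_volume_ball_le {N : ℕ} {Ω : Set (Euc N)} {u ζ P Q : Euc N → ℝ}
    {ε κ a t m' : ℝ} (hcut : IsCutoff Ω u ε ζ P Q) (hN : 0 < N) (hΩ : IsOpen Ω)
    (hb : Bornology.IsBounded Ω) (hu : IsTorsion Ω u) (hκ0 : 0 < κ) (hκ : κ ≤ 1)
    (hcone : BallCone κ a Ω) (ht : t ∈ Ioo 0 (a / 2)) (hε : 16 * ε ≤ (κ * t) ^ 2) (hm' : 0 ≤ m')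
    (hgrad : ∀ x ∈ Ω, -2 * ε ≤ u x → m' ≤ ‖fderiv ℝ u x‖) {x : Euc N} (hx : x ∈ frontier Ω) :
    ENNReal.ofReal m' * volume (ball (0 : Euc N) (κ * t / 2)) ≤
      ENNReal.ofReal (2 * t) * ∫⁻ y in closedBall x (2 * t), ENNReal.ofReal (Q y) := by
  obtain ⟨ω, hω, hball⟩ := hcone x hx
  have ht0 := ht.1
  have hκt : 0 < κ * t := by positivity
  have hκt' : κ * t ≤ t := by nlinarith
  have hxΩ : x ∉ Ω := fun h => hx.2 (by rwa [hΩ.interior_eq])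
  have hdist : ∀ w ∈ ball (x - t • ω) (κ * t / 2), ∀ s ∈ Icc 0 (2 * t),
      dist (w + s • ω) x ≤ 2 * t := by
    intro w hw s hs
    have h1 : w + s • ω - x = (w - (x - t • ω)) + (s - t) • ω := by module
    rw [mem_ball, dist_eq_norm] at hw
    rw [dist_eq_norm, h1]
    refine (norm_add_le _ _).trans ?_
    rw [norm_smul, hω, mul_one, Real.norm_eq_abs]
    have : |s - t| ≤ t := abs_le.2 ⟨by linarith [hs.1], by linarith [hs.2]⟩
    linarith
  have hzero : ∀ w ∈ ball (x - t • ω) (κ * t / 2), P w = 0 := by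
    intro w hw
    refine hcut.eq_zero w fun hwΩ => hxΩ ?_
    have h0 := hdist w hw 0 ⟨le_rfl, by linarith⟩
    rw [zero_smul, add_zero] at h0
    refine hball w ⟨mem_ball.2 (by linarith [ht.2]), subset_closure hwΩ⟩ t ht ?_
    rw [mem_ball, dist_eq_norm] at hw ⊢
    rw [show x - (w + t • ω) = -(w - (x - t • ω)) by module, norm_neg]
    linarith
  have hone : ∀ w ∈ ball (x - t • ω) (κ * t / 2), P (w + (2 * t) • ω) = 1 := by
    intro w hw
    have hsub : ball (w + (2 * t) • ω) (κ * t / 2) ⊆ Ω := by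
      refine Subset.trans ?_ (hball x ⟨mem_ball_self (by linarith [ht.2]), hx.1⟩ t ht)
      refine ball_subset_ball' ?_
      rw [mem_ball, dist_eq_norm] at hw
      rw [dist_eq_norm, show w + (2 * t) • ω - (x + t • ω) = w - (x - t • ω) by module]
      linarith
    have h2 := hu.le_of_ball_subset hN hΩ hb (by positivity) hsub
    exact hcut.eq_one _ (hsub (mem_ball_self (by positivity))) (by nlinarith)
  have hline : ∀ w ∈ ball (x - t • ω) (κ * t / 2),
      ENNReal.ofReal m' ≤ ∫⁻ s in Icc 0 (2 * t), ENNReal.ofReal (Q (w + s • ω)) := by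
    intro w hw
    have h1 := enorm_sub_le_lintegral_fderiv isOpen_univ hcut.contDiff_one.contDiffOn
      (w := w) (e := ω) (L := 2 * t) (by positivity) fun _ _ => mem_univ _
    rw [hone w hw, hzero w hw, sub_zero, enorm_one] at h1
    calc ENNReal.ofReal m' ≤ ENNReal.ofReal m' *
          ∫⁻ s in Icc 0 (2 * t), ‖fderiv ℝ P (w + s • ω)‖ₑ * ‖ω‖ₑ :=
          le_mul_of_one_le_right' h1
      _ = ∫⁻ s in Icc 0 (2 * t), ENNReal.ofReal m' * (‖fderiv ℝ P (w + s • ω)‖ₑ * ‖ω‖ₑ) :=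
          (lintegral_const_mul' _ _ ENNReal.ofReal_ne_top).symm
      _ ≤ _ := by
          refine lintegral_mono fun s => ?_
          have hω' : ‖ω‖ₑ = 1 := by rw [← ofReal_norm, hω, ENNReal.ofReal_one]
          rw [hω', mul_one, ← ofReal_norm, ← ENNReal.ofReal_mul hm']
          exact ENNReal.ofReal_le_ofReal (hcut.mul_norm_fderiv_le m' hgrad _)
  have hQm : Measurable fun y => ENNReal.ofReal (Q y) :=
    hcut.continuous_density.measurable.ennreal_ofReal
  calc ENNReal.ofReal m' * volume (ball (0 : Euc N) (κ * t / 2))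
      = ∫⁻ _ in ball (x - t • ω) (κ * t / 2), ENNReal.ofReal m' := by
        rw [setLIntegral_const, Measure.addHaar_ball_center volume (x - t • ω)]
    _ ≤ ∫⁻ w in ball (x - t • ω) (κ * t / 2),
          ∫⁻ s in Icc 0 (2 * t), ENNReal.ofReal (Q (w + s • ω)) :=
        setLIntegral_mono' measurableSet_ball hline
    _ = ∫⁻ y, ENNReal.ofReal (Q y) *
          volume {s : ℝ | s ∈ Icc 0 (2 * t) ∧ y - s • ω ∈ ball (x - t • ω) (κ * t / 2)} :=
        setLIntegral_line_eq measurableSet_ball hQm ω (2 * t)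
    _ ≤ ∫⁻ y in closedBall x (2 * t), ENNReal.ofReal (2 * t) * ENNReal.ofReal (Q y) := by
        rw [← lintegral_indicator measurableSet_closedBall]
        refine lintegral_mono fun y => ?_
        by_cases hy : y ∈ closedBall x (2 * t)
        · rw [indicator_of_mem hy, mul_comm]
          refine mul_le_mul' ((measure_mono fun s hs => hs.1).trans ?_) le_rfl
          rw [Real.volume_Icc, sub_zero]
        · have : {s : ℝ | s ∈ Icc 0 (2 * t) ∧ y - s • ω ∈ ball (x - t • ω) (κ * t / 2)} = ∅ := by
            refine eq_empty_of_forall_notMem fun s hs => hy ?_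
            have := hdist _ hs.2 s hs.1
            rwa [sub_add_cancel] at this
          rw [this, measure_empty, mul_zero]
          exact zero_le
    _ = _ := lintegral_const_mul' _ _ ENNReal.ofReal_ne_top

open Topology Filter in
/-- A set all of whose small balls carry mass at least `c r ^ s` eventually along a sequence of
measures has Hausdorff measure controlled by the lower limit of the masses of a neighbourhood. -/
theorem hausdorffMeasure_le_mul_liminf_thickening {E : Type*} [MetricSpace E] [MeasurableSpace E]
    [BorelSpace E] [TopologicalSpace.SeparableSpace E] {S : Set E} {ν : ℕ → Measure E}
    {c s r₀ : ℝ} (hc : 0 < c) (hs : 0 ≤ s) (hr₀ : 0 < r₀)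
    (hν : ∀ r ∈ Ioo 0 r₀, ∀ᶠ n in atTop, ∀ x ∈ S,
      ENNReal.ofReal (c * r ^ s) ≤ ν n (closedBall x r))
    {A : Set E} (hA : A ⊆ S) {η : ℝ} (hη : 0 < η) :
    μH[s] A ≤ ENNReal.ofReal (10 ^ s / c) * liminf (fun n => ν n (thickening η A)) atTop := by
  set ρ : ℝ := min r₀ η with hρdef
  have hρ : 0 < ρ := lt_min hr₀ hη
  set r : ℕ → ℝ := fun k => ρ * (1 / (k + 2)) with hr
  have hr0 : ∀ k, 0 < r k := fun k => by positivity
  have hrρ : ∀ k, r k < ρ := fun k => by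
    have : (1 : ℝ) / (k + 2) < 1 := by
      rw [div_lt_one (by positivity)]
      have : (0 : ℝ) ≤ k := k.cast_nonneg
      linarith
    calc r k < ρ * 1 := mul_lt_mul_of_pos_left this hρ
      _ = ρ := mul_one _
  have hrlim : Tendsto r atTop (𝓝 0) := by
    have h1 : Tendsto (fun k : ℕ => (1 : ℝ) / (k + 2)) atTop (𝓝 0) :=
      tendsto_const_nhds.div_atTop
        (tendsto_atTop_add_const_right _ _ tendsto_natCast_atTop_atTop)
    simpa [hr] using h1.const_mul ρ
  choose I hIA hId hIc using fun k => Vitali.exists_disjoint_subfamily_covering_enlargement_closedBall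
    A (fun x => x) (fun _ => r k) (r k) (fun _ _ => le_rfl) 5 (by norm_num)
  have hIct : ∀ k, Countable (I k) := fun k =>
    ((hId k).countable_of_nonempty_interior fun x _ =>
      ⟨x, ball_subset_interior_closedBall (mem_ball_self (hr0 k))⟩).to_subtype
  have hdiam : ∀ k (x : E), ediam (closedBall x (5 * r k)) ≤ ENNReal.ofReal (10 * r k) := by
    intro k x
    refine ediam_le_of_forall_dist_le fun y hy z hz => ?_
    have := dist_triangle_right y z x
    rw [mem_closedBall] at hy hz
    linarith
  have hH := Measure.hausdorffMeasure_le_liminf_tsum (ι := fun k => I k) (l := atTop) s A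
    (fun k => ENNReal.ofReal (10 * r k))
    (by simpa using ENNReal.tendsto_ofReal (hrlim.const_mul 10))
    (fun k x => closedBall (x : E) (5 * r k))
    (Eventually.of_forall fun k x => hdiam k x)
    (Eventually.of_forall fun k x hx => by
      obtain ⟨y, hy, hxy⟩ := hIc k x hx
      exact mem_iUnion.2 ⟨⟨y, hy⟩, hxy (mem_closedBall_self (hr0 k).le)⟩)
  refine hH.trans (liminf_le_of_le (by isBoundedDefault) fun b hb => ?_)
  obtain ⟨k, hk⟩ := hb.exists
  refine hk.trans ?_
  have hmass : ∑' _ : I k, ENNReal.ofReal (c * r k ^ s) ≤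
      liminf (fun n => ν n (thickening η A)) atTop := by
    refine le_liminf_of_le (by isBoundedDefault) ?_
    filter_upwards [hν (r k) ⟨hr0 k, (hrρ k).trans_le (min_le_left _ _)⟩] with n hn
    calc ∑' _ : I k, ENNReal.ofReal (c * r k ^ s)
        ≤ ∑' x : I k, ν n (closedBall (x : E) (r k)) :=
          ENNReal.tsum_le_tsum fun x => hn x (hA (hIA k x.2))
      _ = ν n (⋃ x : I k, closedBall (x : E) (r k)) := by
          refine (measure_iUnion (fun x y hxy => ?_) fun x => isClosed_closedBall.measurableSet).symm
          exact hId k x.2 y.2 fun h => hxy (Subtype.ext h)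
      _ ≤ ν n (thickening η A) := by
          refine measure_mono (iUnion_subset fun x y hy => ?_)
          exact mem_thickening_iff.2 ⟨x, hIA k x.2,
            lt_of_le_of_lt hy ((hrρ k).trans_le (min_le_right _ _))⟩
  refine le_trans ?_ (mul_le_mul' le_rfl hmass)
  rw [← ENNReal.tsum_mul_left]
  refine ENNReal.tsum_le_tsum fun x => ?_
  have h10 : (10 * r k) ^ s = 10 ^ s / c * (c * r k ^ s) := by
    rw [Real.mul_rpow (by norm_num) (hr0 k).le]
    field_simp
  rw [← ENNReal.ofReal_mul (by positivity), ← h10,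
    ← ENNReal.ofReal_rpow_of_nonneg (by linarith [hr0 k]) hs]
  exact ENNReal.rpow_le_rpow (hdiam k x) hs

open Topology Filter in
/-- Passing from masses of neighbourhoods to integrals of continuous functions. -/
theorem setLIntegral_le_of_measure_le_liminf_thickening {E : Type*} [MetricSpace E]
    [MeasurableSpace E] [BorelSpace E] {μ : Measure E} {S K : Set E} (hK : IsCompact K)
    (hS : IsClosed S) (hSK : S ⊆ K) {ν : ℕ → Measure E} {C B M : ENNReal} (hM : M ≠ ⊤)
    (hνK : ∀ n, ν n Kᶜ = 0) (hνM : ∀ n, ν n K ≤ M) {f : E → ℝ} (hf : ContinuousOn f K)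
    (hf0 : ∀ x, 0 ≤ f x) (hC : C ≠ ⊤)
    (hB : ∀ n, ∫⁻ x in K, ENNReal.ofReal (f x) ∂ν n ≤ B)
    (hμ : ∀ A ⊆ S, ∀ η > 0, μ A ≤ C * liminf (fun n => ν n (thickening η A)) atTop) :
    ∫⁻ x in S, ENNReal.ofReal (f x) ∂μ ≤ C * B := by
  have key : ∀ η : ℝ, 0 < η →
      ∫⁻ x in S, ENNReal.ofReal (f x) ∂μ ≤ C * (B + ENNReal.ofReal η * M) := by
    intro η hη
    obtain ⟨δ, hδ, hfδ⟩ := Metric.uniformContinuousOn_iff.1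
      (hK.uniformContinuousOn_of_continuous hf) η hη
    rw [lintegral_eq_lintegral_meas_lt _ (Eventually.of_forall hf0)
      ((hf.mono hSK).aemeasurable hS.measurableSet)]
    have hlevel : ∀ t : ℝ, (μ.restrict S) {x | t < f x} ≤
        C * liminf (fun n => ((ν n).restrict K) {x | t < f x + η}) atTop := by
      intro t
      rw [Measure.restrict_apply' hS.measurableSet]
      refine (hμ _ inter_subset_right δ hδ).trans (mul_le_mul' le_rfl ?_)
      refine liminf_le_liminf (Eventually.of_forall fun n => ?_)
      rw [Measure.restrict_apply' hK.measurableSet]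
      have hsub : thickening δ ({x | t < f x} ∩ S) ⊆ ({x | t < f x + η} ∩ K) ∪ Kᶜ := by
        intro y hy
        by_cases hyK : y ∈ K
        · obtain ⟨x, hx, hxy⟩ := mem_thickening_iff.1 hy
          have h1 := hfδ y hyK x (hSK hx.2) hxy
          have h2 : t < f x := hx.1
          rw [Real.dist_eq, abs_lt] at h1
          exact Or.inl ⟨show t < f y + η by linarith, hyK⟩
        · exact Or.inr hyK
      refine (measure_mono hsub).trans ((measure_union_le _ _).trans ?_)
      rw [hνK n, add_zero]
    calc ∫⁻ t in Ioi 0, (μ.restrict S) {x | t < f x}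
        ≤ ∫⁻ t in Ioi (0 : ℝ),
            C * liminf (fun n => ((ν n).restrict K) {x | t < f x + η}) atTop :=
          lintegral_mono fun t => hlevel t
      _ = C * ∫⁻ t in Ioi (0 : ℝ), liminf (fun n => ((ν n).restrict K) {x | t < f x + η}) atTop :=
          lintegral_const_mul' _ _ hC
      _ ≤ C * liminf (fun n =>
            ∫⁻ t in Ioi (0 : ℝ), ((ν n).restrict K) {x | t < f x + η}) atTop := by
          refine mul_le_mul' le_rfl (lintegral_liminf_le fun n => Antitone.measurable ?_)
          exact fun t t' htt => measure_mono fun x hx => lt_of_le_of_lt htt hx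
      _ ≤ C * (B + ENNReal.ofReal η * M) := by
          refine mul_le_mul' le_rfl (liminf_le_of_frequently_le' (Frequently.of_forall fun n => ?_))
          rw [← lintegral_eq_lintegral_meas_lt _
            (Eventually.of_forall fun x => add_nonneg (hf0 x) hη.le)
            ((hf.add continuousOn_const).aemeasurable hK.measurableSet)]
          simp only [ENNReal.ofReal_add (hf0 _) hη.le]
          rw [lintegral_add_right _ measurable_const, setLIntegral_const]
          exact add_le_add (hB n) (mul_le_mul' le_rfl (hνM n))
  have hlim : Tendsto (fun η : ℝ => C * (B + ENNReal.ofReal η * M)) (𝓝[>] 0)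
      (𝓝 (C * (B + ENNReal.ofReal 0 * M))) := by
    refine ENNReal.Tendsto.const_mul (tendsto_const_nhds.add ?_) (Or.inr hC)
    exact ENNReal.Tendsto.mul_const ((ENNReal.continuous_ofReal.tendsto 0).mono_left
      nhdsWithin_le_nhds) (Or.inr hM)
  have := ge_of_tendsto hlim (eventually_mem_nhdsWithin.mono fun η hη => key η hη)
  simpa using this

open Topology Filter in
/-- Trace inequality for harmonic functions on the boundary of a domain whose torsion function has
nonvanishing gradient on the boundary. -/
theorem exists_boundary_energy_le (N : ℕ) (hN : 0 < N) {κ a m : ℝ} (hκ0 : 0 < κ) (hκ : κ ≤ 1)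
    (ha : 0 < a) (hm : 0 < m) :
    ∃ C : ENNReal, C ≠ ⊤ ∧ ∀ Ω : Set (Euc N), IsOpen Ω → Bornology.IsBounded Ω → BallCone κ a Ω →
      ∀ u : Euc N → ℝ, IsTorsion Ω u →
      ∀ g : Euc N → Euc N, ContinuousOn g (closure Ω) → (∀ x ∈ Ω, g x = gradient u x) →
      (∀ x ∈ frontier Ω, m ≤ ‖g x‖) →
      ∀ h : Euc N → ℝ, ContDiffOn ℝ 2 h Ω → (∀ x ∈ Ω, lap h x = 0) →
      ∀ f : Euc N → ℝ, ContinuousOn f (closure Ω) → (∀ x, 0 ≤ f x) →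
      (∀ x ∈ Ω, f x = ‖fderiv ℝ h x‖ ^ 2) →
      ∫⁻ x in frontier Ω, ENNReal.ofReal (f x) ∂(μH[(N : ℝ) - 1]) ≤
        C * (N * (∫⁻ x in Ω, ENNReal.ofReal (‖fderiv ℝ h x‖ ^ 2)) +
          2 * ∫⁻ x in Ω, ENNReal.ofReal (-u x * hessNormSq h x)) := by
  set V : ℝ := (volume (ball (0 : Euc N) 1)).toReal with hV
  have hV0 : 0 < V := ENNReal.toReal_pos (measure_ball_pos _ _ one_pos).ne' measure_ball_lt_top.ne
  set c : ℝ := m / 2 * ((κ / 4) ^ N * V) with hc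
  have hc0 : 0 < c := by positivity
  have hs : (0 : ℝ) ≤ (N : ℝ) - 1 := by
    have : (1 : ℝ) ≤ N := by exact_mod_cast hN
    linarith
  refine ⟨ENNReal.ofReal (10 ^ ((N : ℝ) - 1) / c), ENNReal.ofReal_ne_top, ?_⟩
  intro Ω hΩ hb hcone u hu g hgc hg hgm h hh hl f hfc hf0 hf
  have hgn : ∀ x ∈ Ω, ‖g x‖ = ‖fderiv ℝ u x‖ := fun x hx => by
    rw [hg x hx, gradient, LinearIsometryEquiv.norm_map]
  obtain ⟨ε, hε, hgε⟩ := exists_half_le_norm_of_neg_le hb hu.1 (hu.neg hN hΩ hb) hgc hm hgm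
  have hεn : ∀ n : ℕ, 0 < ε / 2 * (1 / ((n : ℝ) + 1)) := fun n => by positivity
  choose ζ P Q hcut using fun n => hu.exists_isCutoff hN hΩ hb (hεn n)
  have hgrad : ∀ n : ℕ, ∀ x ∈ Ω, -2 * (ε / 2 * (1 / ((n : ℝ) + 1))) ≤ u x →
      m / 2 ≤ ‖fderiv ℝ u x‖ := by
    intro n x hx hxu
    rw [← hgn x hx]
    refine hgε x hx (le_trans ?_ hxu)
    have : 1 / ((n : ℝ) + 1) ≤ 1 := by
      rw [div_le_one (by positivity)]
      linarith [(n.cast_nonneg : (0 : ℝ) ≤ n)]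
    nlinarith
  have hεlim : Tendsto (fun n : ℕ => 16 * (ε / 2 * (1 / ((n : ℝ) + 1)))) atTop (𝓝 0) := by
    simpa using (tendsto_one_div_add_atTop_nhds_zero_nat.const_mul (ε / 2)).const_mul (16 : ℝ)
  set ν : ℕ → Measure (Euc N) := fun n => volume.withDensity fun x => ENNReal.ofReal (Q n x) with hν
  have hQm : ∀ n, Measurable fun x => ENNReal.ofReal (Q n x) := fun n =>
    (hcut n).continuous_density.measurable.ennreal_ofReal
  have hlower : ∀ r ∈ Ioo 0 a, ∀ᶠ n in atTop, ∀ x ∈ frontier Ω,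
      ENNReal.ofReal (c * r ^ ((N : ℝ) - 1)) ≤ ν n (closedBall x r) := by
    intro r hr
    have hr0 := hr.1
    filter_upwards [hεlim.eventually_lt_const (show 0 < (κ * (r / 2)) ^ 2 by positivity)]
      with n hn x hx
    have h1 := (hcut n).mul_volume_ball_le hN hΩ hb hu hκ0 hκ hcone
      (t := r / 2) ⟨by positivity, by linarith [hr.2]⟩ hn.le (by positivity) (hgrad n) hx
    rw [Measure.addHaar_ball_of_pos _ _ (by positivity), finrank_euclideanSpace_fin,
      ← ENNReal.ofReal_toReal (measure_ball_lt_top (μ := volume) (x := (0 : Euc N)) (r := 1)).ne,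
      ← ENNReal.ofReal_mul (by positivity), ← ENNReal.ofReal_mul (by positivity),
      mul_div_cancel₀ r two_ne_zero] at h1
    have h2 : m / 2 * ((κ * (r / 2) / 2) ^ N * V) = r * (c * r ^ ((N : ℝ) - 1)) := by
      rw [Real.rpow_sub_one hr0.ne', Real.rpow_natCast, hc,
        show κ * (r / 2) / 2 = κ / 4 * r by ring, mul_pow]
      field_simp
    rw [← hV, h2, ENNReal.ofReal_mul hr0.le] at h1
    rw [hν, withDensity_apply _ measurableSet_closedBall]
    exact (ENNReal.mul_le_mul_iff_right (by simpa using hr0) ENNReal.ofReal_ne_top).1 h1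
  have hcl : MeasurableSet (closure Ω) := isClosed_closure.measurableSet
  refine setLIntegral_le_of_measure_le_liminf_thickening (ν := ν) (K := closure Ω)
    (M := N * volume Ω) hb.isCompact_closure isClosed_frontier frontier_subset_closure
    (ENNReal.mul_ne_top (ENNReal.natCast_ne_top N) hb.measure_lt_top.ne) (fun n => ?_) (fun n => ?_)
    hfc hf0 ENNReal.ofReal_ne_top (fun n => ?_) fun A hA η hη =>
      hausdorffMeasure_le_mul_liminf_thickening hc0 hs ha hlower hA hη
  · rw [hν, withDensity_apply _ hcl.compl, setLIntegral_congr_fun (g := fun _ => 0) hcl.compl,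
      lintegral_zero]
    intro x hx
    simp [(hcut n).density_eq_zero x fun h' => hx (subset_closure h')]
  · rw [hν, withDensity_apply _ hcl]
    exact (setLIntegral_le_lintegral _ _).trans ((hcut n).lintegral_density_le hΩ)
  · rw [hν, restrict_withDensity hcl]
    refine (lintegral_withDensity_le_lintegral_mul _ (hQm n) _).trans
      ((setLIntegral_le_lintegral _ _).trans
        (le_trans (lintegral_mono fun x => ?_) ((hcut n).lintegral_density_mul_le hΩ hh hl)))
    by_cases hx : x ∈ Ω
    · simp only [Pi.mul_apply]
      rw [ENNReal.ofReal_mul ((hcut n).density_nonneg x), hf x hx]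
    · simp [(hcut n).density_eq_zero x hx]

/-- The mean minimises the `L²` distance to constants. -/
theorem lintegral_enorm_sq_le_of_integral_eq_zero {X : Type*} [MeasurableSpace X] {μ : Measure X}
    [IsFiniteMeasure μ] {v : X → ℝ} (hv : MemLp v 2 μ) (h0 : ∫ x, v x ∂μ = 0) (c : ℝ) :
    ∫⁻ x, ‖v x‖ₑ ^ 2 ∂μ ≤ ∫⁻ x, ‖v x - c‖ₑ ^ 2 ∂μ := by
  have hsq : ∀ y : ℝ, ‖y‖ₑ ^ 2 = ENNReal.ofReal (y ^ 2) := fun y => by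
    rw [← ofReal_norm, ← ENNReal.ofReal_pow (norm_nonneg _), Real.norm_eq_abs, sq_abs]
  have hvI : Integrable v μ := hv.integrable (by norm_num)
  have hv2 : Integrable (fun x => v x ^ 2) μ := hv.integrable_sq
  have hc2 : Integrable (fun x => (v x - c) ^ 2) μ := (hv.sub (memLp_const c)).integrable_sq
  simp only [hsq]
  rw [← ofReal_integral_eq_lintegral_ofReal hv2 (Filter.Eventually.of_forall fun _ => sq_nonneg _),
    ← ofReal_integral_eq_lintegral_ofReal hc2 (Filter.Eventually.of_forall fun _ => sq_nonneg _)]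
  refine ENNReal.ofReal_le_ofReal ?_
  have h1 : ∫ x, (v x - c) ^ 2 ∂μ = ∫ x, (v x ^ 2 + ((-2 * c) * v x + c ^ 2)) ∂μ :=
    integral_congr_ae (Filter.Eventually.of_forall fun x => by ring)
  have hlin : Integrable (fun x => (-2 * c) * v x) μ := hvI.const_mul _
  have haff : Integrable (fun x => (-2 * c) * v x + c ^ 2) μ := hlin.add (integrable_const _)
  rw [h1, integral_add hv2 haff, integral_add hlin (integrable_const _),
    integral_const_mul, h0, mul_zero, zero_add, integral_const, smul_eq_mul]
  exact le_add_of_nonneg_right (by positivity)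

theorem sum_enorm_fderiv_sq_eq {N : ℕ} (h : Euc N → ℝ) (x : Euc N) :
    ∑ j, ‖fderiv ℝ (fun y => fderiv ℝ h y (EuclideanSpace.single j 1)) x‖ₑ ^ 2 =
      ENNReal.ofReal (hessNormSq h x) := by
  rw [sum_sq_hessEntry_eq, ENNReal.ofReal_sum_of_nonneg
    fun _ _ => Finset.sum_nonneg fun _ _ => sq_nonneg _]
  refine Finset.sum_congr rfl fun j _ => ?_
  rw [← ofReal_norm, ← ENNReal.ofReal_pow (norm_nonneg _), ← sum_sq_apply_single]
  rfl

/-- Weighted Poincaré inequality for the gradient of a function with mean-zero gradient. -/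
theorem exists_energy_le_weighted_hessian (N : ℕ) (hN : 0 < N) {κ a : ℝ} (hκ0 : 0 < κ) (hκ : κ ≤ 1)
    (ha : 0 < a) (d : ℝ) :
    ∃ C : ENNReal, C ≠ ⊤ ∧ ∀ Ω : Set (Euc N), IsOpen Ω → IsConnected Ω → Bornology.IsBounded Ω →
      Metric.diam Ω ≤ d → BallCone κ a Ω → ∀ u : Euc N → ℝ, IsTorsion Ω u →
      ∀ h : Euc N → ℝ, ContDiffOn ℝ 2 h Ω → (∃ M, ∀ x ∈ Ω, ‖fderiv ℝ h x‖ ≤ M) →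
      (∀ j, ∫ x in Ω, fderiv ℝ h x (EuclideanSpace.single j 1) = 0) →
      ∫⁻ x in Ω, ENNReal.ofReal (‖fderiv ℝ h x‖ ^ 2) ≤
        C * ∫⁻ x in Ω, ENNReal.ofReal (-u x * hessNormSq h x) := by
  obtain ⟨C, hC, hP⟩ := exists_global_weighted_poincare N hN hκ0 hκ ha d
  refine ⟨C * 2, ENNReal.mul_ne_top hC (by simp), ?_⟩
  intro Ω hΩ hconn hb hd hcone u hu h hh ⟨M, hM⟩ h0
  have : IsFiniteMeasure (volume.restrict Ω) := ⟨by simpa using hb.measure_lt_top⟩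
  set v : Fin N → Euc N → ℝ := fun j x => fderiv ℝ h x (EuclideanSpace.single j 1) with hv
  have hvm : ∀ j, Measurable (v j) := fun j => measurable_fderiv_apply_const ℝ h _
  have hvC : ∀ j, ContDiffOn ℝ 1 (v j) Ω :=
    fun j x hx => (contDiffAt_fderiv_apply (hh.contDiffAt (hΩ.mem_nhds hx)) _).contDiffWithinAt
  have hvM : ∀ j, ∀ x ∈ Ω, |v j x| ≤ M := fun j x hx => by
    have := (fderiv ℝ h x).le_opNorm (EuclideanSpace.single j 1)
    rw [PiLp.norm_single, norm_one, mul_one] at this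
    exact this.trans (hM x hx)
  have hW : ∀ x r, 0 < r → ball x r ⊆ Ω → r ^ 2 ≤ 2 * -u x := fun x r hr hx => by
    have := hu.le_of_ball_subset hN hΩ hb hr hx
    linarith
  have hj : ∀ j, ∫⁻ x in Ω, ‖v j x‖ₑ ^ 2 ≤
      C * ∫⁻ x in Ω, ENNReal.ofReal (2 * -u x) * ‖fderiv ℝ (v j) x‖ₑ ^ 2 := by
    intro j
    obtain ⟨c, hc⟩ := hP Ω hΩ hconn hb hd hcone (fun x => 2 * -u x) hW (v j) (hvm j) (hvC j)
      ⟨M, hvM j⟩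
    refine (lintegral_enorm_sq_le_of_integral_eq_zero ?_ (h0 j) c).trans hc
    refine MemLp.of_bound (hvm j).aestronglyMeasurable M ?_
    filter_upwards [ae_restrict_mem hΩ.measurableSet] with x hx using hvM j x hx
  have hneg := hu.neg hN hΩ hb
  have hwm : AEMeasurable (fun x => ENNReal.ofReal (2 * -u x)) (volume.restrict Ω) :=
    ((hu.2.1.continuousOn.aemeasurable hΩ.measurableSet).neg.const_mul 2).ennreal_ofReal
  calc ∫⁻ x in Ω, ENNReal.ofReal (‖fderiv ℝ h x‖ ^ 2)
      = ∫⁻ x in Ω, ∑ j, ‖v j x‖ₑ ^ 2 := by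
        refine lintegral_congr fun x => ?_
        rw [← sum_sq_apply_single, ENNReal.ofReal_sum_of_nonneg fun _ _ => sq_nonneg _]
        refine Finset.sum_congr rfl fun j _ => ?_
        rw [← ofReal_norm, ← ENNReal.ofReal_pow (norm_nonneg _), Real.norm_eq_abs, sq_abs]
    _ = ∑ j, ∫⁻ x in Ω, ‖v j x‖ₑ ^ 2 :=
        lintegral_finsetSum _ fun j _ => (hvm j).enorm.pow_const 2
    _ ≤ ∑ j, C * ∫⁻ x in Ω, ENNReal.ofReal (2 * -u x) * ‖fderiv ℝ (v j) x‖ₑ ^ 2 :=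
        Finset.sum_le_sum fun j _ => hj j
    _ = C * ∫⁻ x in Ω, ENNReal.ofReal (2 * -u x) * ∑ j, ‖fderiv ℝ (v j) x‖ₑ ^ 2 := by
        have hm : ∀ j, AEMeasurable (fun x => ENNReal.ofReal (2 * -u x) *
            ‖fderiv ℝ (v j) x‖ₑ ^ 2) (volume.restrict Ω) := fun j =>
          hwm.mul ((measurable_fderiv ℝ (v j)).enorm.pow_const 2).aemeasurable
        rw [← Finset.mul_sum, ← lintegral_finsetSum' _ fun j _ => hm j]
        simp only [Finset.mul_sum]
    _ = C * ∫⁻ x in Ω, 2 * ENNReal.ofReal (-u x * hessNormSq h x) := by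
        congr 1
        refine setLIntegral_congr_fun hΩ.measurableSet fun x hx => ?_
        simp only [hv, sum_enorm_fderiv_sq_eq]
        rw [ENNReal.ofReal_mul two_pos.le, ENNReal.ofReal_mul (by linarith [hneg x hx]),
          ENNReal.ofReal_ofNat, mul_assoc]
    _ = C * 2 * ∫⁻ x in Ω, ENNReal.ofReal (-u x * hessNormSq h x) := by
        rw [lintegral_const_mul' _ _ (by simp), mul_assoc]

theorem hessNormSq_affine_quad_le {N : ℕ} {u : Euc N → ℝ} {x : Euc N} (hu : ContDiffAt ℝ 2 u x)
    (k : ℝ) (z : Euc N) :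
    hessNormSq (fun y => -1 * u y + 1 * (‖y - z‖ ^ 2 / 2) + k) x ≤ 2 * hessNormSq u x + 2 * N := by
  have h1 : ∀ i j, hessEntry (fun y => -1 * u y + 1 * (‖y - z‖ ^ 2 / 2) + k) x i j ^ 2 ≤
      2 * hessEntry u x i j ^ 2 + 2 * (if i = j then 1 else 0) := fun i j => by
    rw [hessEntry_affine_quad hu]
    split_ifs <;> nlinarith [sq_nonneg (hessEntry u x i j + 1), sq_nonneg (hessEntry u x i j)]
  refine (Finset.sum_le_sum fun i _ => Finset.sum_le_sum fun j _ => h1 i j).trans (le_of_eq ?_)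
  simp [hessNormSq, Finset.sum_add_distrib, Finset.mul_sum, mul_comm]

/-- weighted trace inequality for `∇h`. -/
theorem stmt_9 (N : ℕ) (hN : 2 ≤ N) (θ a d m : ℝ) (hθ : θ ∈ Ioc (0:ℝ) (π / 2))
    (ha : 0 < a) (hd : 0 < d) (hm : 0 < m) :
    ∃ C > (0:ℝ), ∀ Ω : Set (Euc N), IsOpen Ω → IsConnected Ω → Bornology.IsBounded Ω →
      Metric.diam Ω ≤ d → UnifConeCond θ a Ω →
      ∀ u : Euc N → ℝ, IsTorsion Ω u →
      ∀ g : Euc N → Euc N, ContinuousOn g (closure Ω) → (∀ x ∈ Ω, g x = gradient u x) →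
      (∀ x ∈ frontier Ω, m ≤ ‖g x‖) →
      IntegrableOn (fun x => hessNormSq u x) Ω volume →
      ∀ z : Euc N, z = (⨍ x in Ω, x) →
      ∀ h : Euc N → ℝ, h = (fun x => ‖x - z‖ ^ 2 / 2 - u x) →
      (∫ x in frontier Ω, ‖x - z - g x‖ ^ 2 ∂(μH[(N:ℝ) - 1])) ≤
        C * ∫ x in Ω, (-u x) * hessNormSq h x := by
  have hN0 : 0 < N := by omega
  have hcos : cos θ < 1 := by
    simpa using cos_lt_cos_of_nonneg_of_le_pi_div_two le_rfl hθ.2 hθ.1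
  have hκ0 : 0 < (1 - cos θ) / 2 := by linarith
  have hκ : (1 - cos θ) / 2 ≤ 1 := by linarith [neg_one_le_cos θ]
  obtain ⟨Cb, hCb, hbdry⟩ := exists_boundary_energy_le N hN0 hκ0 hκ ha hm
  obtain ⟨Cp, hCp, hpoin⟩ := exists_energy_le_weighted_hessian N hN0 hκ0 hκ ha d
  have hCtop : Cb * (N * Cp + 2) ≠ ⊤ := ENNReal.mul_ne_top hCb
    (ENNReal.add_ne_top.2 ⟨ENNReal.mul_ne_top (ENNReal.natCast_ne_top N) hCp, by simp⟩)
  refine ⟨(Cb * (N * Cp + 2)).toReal + 1, by positivity, ?_⟩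
  intro Ω hΩ hconn hb hdiam hcone u hu g hgc hg hgm hint z hz h hh
  replace hh : h = fun y => -1 * u y + 1 * (‖y - z‖ ^ 2 / 2) + 0 := by
    rw [hh]
    ext y
    ring
  have hball := hcone.ballCone hθ
  have hneg := hu.neg hN0 hΩ hb
  have hucd : ∀ x ∈ Ω, ContDiffAt ℝ 2 u x := fun x hx => hu.2.1.contDiffAt (hΩ.mem_nhds hx)
  have hdh : ∀ x ∈ Ω, ∀ e, fderiv ℝ h x e = -1 * fderiv ℝ u x e + 1 * ⟪x - z, e⟫ :=
    fun x hx e => by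
      rw [hh]
      exact fderiv_affine_quad ((hucd x hx).differentiableAt (by norm_num)) _ _ _ _ _
  have hgn : ∀ x ∈ Ω, ‖fderiv ℝ u x‖ = ‖g x‖ := fun x hx => by
    rw [hg x hx, gradient, LinearIsometryEquiv.norm_map]
  have hhn : ∀ x ∈ Ω, ‖fderiv ℝ h x‖ = ‖x - z - g x‖ := fun x hx => by
    have : fderiv ℝ h x = innerSL ℝ (x - z - g x) := by
      ext e
      rw [hdh x hx, innerSL_apply_apply, inner_sub_left _ (g x), hg x hx, inner_gradient_left]
      ring
    rw [this, innerSL_apply_norm]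
  have hhC : ContDiffOn ℝ 2 h Ω := by
    rw [hh]
    exact ((contDiffOn_const.mul hu.2.1).add (contDiffOn_const.mul
      (((contDiff_id.sub contDiff_const).norm_sq ℝ).div_const 2).contDiffOn)).add contDiffOn_const
  have hhl : ∀ x ∈ Ω, lap h x = 0 := fun x hx => by
    rw [hh, lap_affine_quad (hucd x hx), hu.2.2.1 x hx]
    ring
  have hpc : ContinuousOn (fun x => x - z - g x) (closure Ω) :=
    (continuousOn_id.sub continuousOn_const).sub hgc
  have hfc : ContinuousOn (fun x => ‖x - z - g x‖ ^ 2) (closure Ω) := hpc.norm.pow 2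
  obtain ⟨M, hM⟩ := hb.isCompact_closure.exists_bound_of_continuousOn hpc
  obtain ⟨G, hG⟩ := hb.isCompact_closure.exists_bound_of_continuousOn hgc
  obtain ⟨U, hU⟩ := hb.isCompact_closure.exists_bound_of_continuousOn hu.1
  have hfin : IsFiniteMeasure (volume.restrict Ω) := ⟨by simpa using hb.measure_lt_top⟩
  have hbI : ∀ (p : Euc N → Euc N), ContinuousOn p (closure Ω) → IntegrableOn p Ω := fun p hp =>
    (hp.integrableOn_compact hb.isCompact_closure).mono_set subset_closure
  have hmean : ∀ j : Fin N, ∫ x in Ω, fderiv ℝ h x (EuclideanSpace.single j 1) = 0 := by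
    intro j
    have hxI : IntegrableOn (fun x => x - z) Ω :=
      hbI _ (continuousOn_id.sub continuousOn_const)
    have hz0 : ∫ x in Ω, (x - z) = 0 := by
      rw [hz]
      exact integral_sub_average (volume.restrict Ω) fun x => x
    have hin : ∫ x in Ω, ⟪EuclideanSpace.single j (1 : ℝ), x - z⟫ = 0 := by
      rw [integral_inner hxI, hz0, inner_zero_right]
    have hdu : ∫ x in Ω, fderiv ℝ u x (EuclideanSpace.single j 1) = 0 :=
      hu.setIntegral_fderiv_eq_zero hN0 hΩ hb
        (fun x hx => (hgn x hx).trans_le (hG x (subset_closure hx))) (by simp)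
    have hduI : IntegrableOn (fun x => ⟪EuclideanSpace.single j (1 : ℝ), g x⟫) Ω :=
      (hbI g hgc).const_inner _
    rw [setIntegral_congr_fun (g := fun x => ⟪EuclideanSpace.single j (1 : ℝ), x - z⟫ -
      ⟪EuclideanSpace.single j (1 : ℝ), g x⟫) hΩ.measurableSet, integral_sub (hxI.const_inner _) hduI,
      hin, setIntegral_congr_fun (g := fun x => fderiv ℝ u x (EuclideanSpace.single j 1))
      hΩ.measurableSet, hdu, sub_zero]
    · intro x hx
      simp only [hg x hx]
      rw [real_inner_comm, inner_gradient_left]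
    · intro x hx
      simp only [hdh x hx, hg x hx]
      rw [real_inner_comm (gradient u x), real_inner_comm (x - z), inner_gradient_left]
      ring
  have hw0 : ∀ x ∈ Ω, 0 ≤ -u x * hessNormSq h x := fun x hx =>
    mul_nonneg (by linarith [hneg x hx]) (hessNormSq_nonneg h x)
  have hwI : IntegrableOn (fun x => -u x * hessNormSq h x) Ω := by
    have hhess : ContinuousOn (fun x => hessNormSq h x) Ω := by
      refine continuousOn_finsetSum _ fun i _ => continuousOn_finsetSum _ fun j _ =>
        ContinuousOn.pow ?_ 2
      have hvj : ContDiffOn ℝ 1 (fun x => fderiv ℝ h x (EuclideanSpace.single j 1)) Ω :=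
        fun x hx => (contDiffAt_fderiv_apply (hhC.contDiffAt (hΩ.mem_nhds hx)) _).contDiffWithinAt
      exact (hvj.continuousOn_fderiv_of_isOpen hΩ le_rfl).clm_apply continuousOn_const
    refine Integrable.mono' (g := fun x => U * (2 * hessNormSq u x + 2 * N))
      (((hint.const_mul 2).add (integrable_const _)).const_mul U)
      ((hu.2.1.continuousOn.neg.mul hhess).aestronglyMeasurable hΩ.measurableSet) ?_
    filter_upwards [ae_restrict_mem hΩ.measurableSet] with x hx
    rw [norm_mul, norm_neg, Real.norm_of_nonneg (hessNormSq_nonneg h x), hh]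
    exact mul_le_mul (hU x (subset_closure hx)) (hessNormSq_affine_quad_le (hucd x hx) _ _)
      (hessNormSq_nonneg _ _) ((norm_nonneg _).trans (hU x (subset_closure hx)))
  have hI0 : 0 ≤ ∫ x in Ω, -u x * hessNormSq h x := setIntegral_nonneg hΩ.measurableSet hw0
  have hIeq := ofReal_integral_eq_lintegral_ofReal hwI
    ((ae_restrict_mem hΩ.measurableSet).mono hw0)
  have hB := hbdry Ω hΩ hb hball u hu g hgc hg hgm h hhC hhl (fun x => ‖x - z - g x‖ ^ 2) hfc
    (fun x => sq_nonneg _) fun x hx => by rw [hhn x hx]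
  have hPo := hpoin Ω hΩ hconn hb hdiam hball u hu h hhC
    ⟨M, fun x hx => (hhn x hx).trans_le (hM x (subset_closure hx))⟩ hmean
  rw [← hIeq] at hB hPo
  have hle : ∫⁻ x in frontier Ω, ENNReal.ofReal (‖x - z - g x‖ ^ 2) ∂(μH[(N : ℝ) - 1]) ≤
      Cb * (N * Cp + 2) * ENNReal.ofReal (∫ x in Ω, -u x * hessNormSq h x) := by
    refine hB.trans (le_trans (mul_le_mul' le_rfl
      (add_le_add (mul_le_mul' le_rfl hPo) le_rfl)) (le_of_eq ?_))
    ring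
  rw [integral_eq_lintegral_of_nonneg_ae (Filter.Eventually.of_forall fun x => sq_nonneg _)
    ((hfc.mono frontier_subset_closure).aestronglyMeasurable isClosed_frontier.measurableSet)]
  refine (ENNReal.toReal_mono (ENNReal.mul_ne_top hCtop ENNReal.ofReal_ne_top) hle).trans ?_
  rw [ENNReal.toReal_mul, ENNReal.toReal_ofReal hI0]
  exact mul_le_mul_of_nonneg_right (by linarith) hI0
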